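/- Let G=(V,w,m,d₀) be a salami with the combinatorial distance d₀, and suppose there is ε > 0 such that w(x,y) ≥ ε for all adjacent x,y. Fix x ∈ V. Then the real vector space { u : V → ℝ : Δu = 0 and max_{B_r(x)} |u| = e^{o(r)} as r → ∞ } of harmonic functions of subexponential growth has dimension exactly 2. -/

import Mathlib

open Filter

namespace SalamiPaper

variable {V : Type*}

/-- Locally finite: every vertex has finitely many neighbors. -/
def LocallyFinite (w : V → V → ℝ) : Prop := ∀ x : V, {y | 0 < w x y}.Finite

/-- Connectedness of the weighted graph: any two vertices are joined by a path. -/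
def GraphConnected (w : V → V → ℝ) : Prop :=
  ∀ x y : V, Relation.ReflTransGen (fun a b => 0 < w a b) x y

/-- The weighted graph Laplacian `Δf(x) = (1/m(x)) ∑_y w(x,y)(f(y)-f(x))`. -/
noncomputable def lap (w : V → V → ℝ) (m : V → ℝ) (f : V → ℝ) (x : V) : ℝ :=
  (m x)⁻¹ * ∑ᶠ y, w x y * (f y - f x)

/-- The vertex degree `Deg(x) = (1/m(x)) ∑_y w(x,y)`. -/
noncomputable def deg (w : V → V → ℝ) (m : V → ℝ) (x : V) : ℝ :=
  (m x)⁻¹ * ∑ᶠ y, w x y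

/-- The set of `d`-lengths of adjacency paths from `x` to `y`. -/
def pathLens (w : V → V → ℝ) (d : V → V → ℝ) (x y : V) : Set ℝ :=
  {L | ∃ (n : ℕ) (p : ℕ → V), p 0 = x ∧ p n = y ∧
    (∀ i < n, 0 < w (p i) (p (i + 1))) ∧
    L = ∑ i ∈ Finset.range n, d (p i) (p (i + 1))}

/-- `d` is a path metric on the graph with edge weight `w`. -/
def IsPathMetric (w : V → V → ℝ) (d : V → V → ℝ) : Prop :=
  (∀ x, d x x = 0) ∧ (∀ x y, x ≠ y → 0 < d x y) ∧ (∀ x y, d x y = d y x) ∧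
  (∀ x y z, d x z ≤ d x y + d y z) ∧
  (∀ x y, d x y = sInf (pathLens w d x y))

/-- All balls are finite. -/
def FiniteBalls (d : V → V → ℝ) : Prop := ∀ (x : V) (R : ℝ), {y | d x y ≤ R}.Finite

/-- The combinatorial graph distance (as a real number). -/
noncomputable def combDist (w : V → V → ℝ) (x y : V) : ℝ :=
  sInf {L | ∃ (n : ℕ) (p : ℕ → V), p 0 = x ∧ p n = y ∧
    (∀ i < n, 0 < w (p i) (p (i + 1))) ∧ L = (n : ℝ)}

/-- `Lip(1)`: the 1-Lipschitz functions with respect to `d`. -/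
def Lip1 (d : V → V → ℝ) (f : V → ℝ) : Prop := ∀ x y, f y - f x ≤ d x y

/-- The Ollivier curvature
`κ(x,y) = (1/d(x,y)) inf{Δf(x) - Δf(y) : f ∈ Lip(1), f(y)-f(x) = d(x,y)}`. -/
noncomputable def kappa (w : V → V → ℝ) (m : V → ℝ) (d : V → V → ℝ) (x y : V) : ℝ :=
  (d x y)⁻¹ * sInf {c | ∃ f : V → ℝ, Lip1 d f ∧ f y - f x = d x y ∧
    c = lap w m f x - lap w m f y}

/-- `m(A) = ∞`: the total measure of `A` is infinite. -/
def InfVolume (m : V → ℝ) (A : Set V) : Prop :=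
  ∀ c : ℝ, ∃ F : Finset V, ↑F ⊆ A ∧ c < ∑ x ∈ F, m x

/-- A salami partition `(X,Y,K)`. -/
def SalamiPartition (w : V → V → ℝ) (m : V → ℝ) (X Y K : Set V) : Prop :=
  X ∪ Y ∪ K = Set.univ ∧ Disjoint X Y ∧ Disjoint X K ∧ Disjoint Y K ∧
  K.Finite ∧ (∀ x ∈ X, ∀ y ∈ Y, w x y = 0) ∧ InfVolume m X ∧ InfVolume m Y

/-- Reachability inside a subset `A` of the vertex set. -/
def reachIn (w : V → V → ℝ) (A : Set V) : V → V → Prop :=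
  Relation.ReflTransGen (fun a b => a ∈ A ∧ b ∈ A ∧ 0 < w a b)

/-- The induced subgraph on `A` is connected. -/
def ConnectedIn (w : V → V → ℝ) (A : Set V) : Prop :=
  ∀ x ∈ A, ∀ y ∈ A, reachIn w A x y

/-- A connected salami partition: `K` induces a connected subgraph. -/
def ConnectedSalamiPartition (w : V → V → ℝ) (m : V → ℝ) (X Y K : Set V) : Prop :=
  SalamiPartition w m X Y K ∧ ConnectedIn w K

/-- The basic standing assumptions on a weighted graph `G = (V,w,m,d)`:
countable vertex set, symmetric non-negative edge weight vanishing on the diagonal,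
positive vertex measure, local finiteness, connectedness,
`d` a path metric with finite balls. -/
def IsGraphBase (w : V → V → ℝ) (m : V → ℝ) (d : V → V → ℝ) : Prop :=
  Countable V ∧ (∀ x y, w x y = w y x) ∧ (∀ x y, 0 ≤ w x y) ∧ (∀ x, w x x = 0) ∧
  (∀ x, 0 < m x) ∧ LocallyFinite w ∧ GraphConnected w ∧
  IsPathMetric w d ∧ FiniteBalls d

/-- Non-negative Ollivier curvature on all edges. -/
def NonnegCurv (w : V → V → ℝ) (m : V → ℝ) (d : V → V → ℝ) : Prop :=
  ∀ x y, 0 < w x y → 0 ≤ kappa w m d x y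

/-- A salami: a connected, locally finite weighted graph with a path metric with
finite balls, non-negative Ollivier curvature, admitting a salami partition. -/
def IsSalami (w : V → V → ℝ) (m : V → ℝ) (d : V → V → ℝ) : Prop :=
  IsGraphBase w m d ∧ NonnegCurv w m d ∧ ∃ X Y K : Set V, SalamiPartition w m X Y K

/-- `G` has at least `n` ends: there is a finite set `K` such that `V ∖ K` has at
least `n` infinite connected components. -/
def atLeastEnds (w : V → V → ℝ) (n : ℕ) : Prop :=
  ∃ K : Set V, K.Finite ∧ ∃ x : Fin n → V,
    (∀ i, x i ∉ K) ∧ (∀ i, {y | reachIn w Kᶜ (x i) y}.Infinite) ∧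
    (∀ i j, i ≠ j → ¬ reachIn w Kᶜ (x i) (x j))

/-- `Lip(1,K)`: functions that are 1-Lipschitz on `K`. -/
def Lip1On (d : V → V → ℝ) (K : Set V) (f : V → ℝ) : Prop :=
  ∀ x ∈ K, ∀ y ∈ K, f y - f x ≤ d x y

open Classical in
/-- The extremal Lipschitz extension operator `S(P)` of the salami partition
`P = (X,Y,K)`. -/
noncomputable def Sop (d : V → V → ℝ) (X Y K : Set V) (f : V → ℝ) : V → ℝ :=
  fun v =>
    if v ∈ K then f v
    else if v ∈ X then sSup {c | ∃ u ∈ K, c = f u - d v u}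
    else sInf {c | ∃ u ∈ K, c = f u + d v u}

/-- `ℱ(P) = S(P)(Lip(1,K))`. -/
def calF (d : V → V → ℝ) (X Y K : Set V) : Set (V → ℝ) :=
  {g | ∃ f : V → ℝ, Lip1On d K f ∧ g = Sop d X Y K f}

/-- `ℋ(P)`: the harmonic functions in `ℱ(P)`. -/
def calH (w : V → V → ℝ) (m : V → ℝ) (d : V → V → ℝ) (X Y K : Set V) :
    Set (V → ℝ) :=
  {g | g ∈ calF d X Y K ∧ ∀ x, lap w m g x = 0}

/-- `∇₊f(x) = max_{y∼x} (f(y)-f(x))/d(x,y)`. -/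
noncomputable def gradPlus (w : V → V → ℝ) (d : V → V → ℝ) (f : V → ℝ) (x : V) : ℝ :=
  sSup {c | ∃ y, 0 < w x y ∧ c = (f y - f x) / d x y}

/-- `∇₋f(x) = max_{y∼x} (f(x)-f(y))/d(x,y)`. -/
noncomputable def gradMinus (w : V → V → ℝ) (d : V → V → ℝ) (f : V → ℝ) (x : V) : ℝ :=
  sSup {c | ∃ y, 0 < w x y ∧ c = (f x - f y) / d x y}

/-- `|∇f|(x) = max_{y∼x} |f(y)-f(x)|/d(x,y)`. -/
noncomputable def gradAbs (w : V → V → ℝ) (d : V → V → ℝ) (f : V → ℝ) (x : V) : ℝ :=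
  sSup {c | ∃ y, 0 < w x y ∧ c = |f y - f x| / d x y}

/-- Recurrence: for every `ε > 0` there is a finitely supported `f` with
`‖f‖∞ = 1` and `-⟨f, Δf⟩ < ε`. -/
def Recurrent (w : V → V → ℝ) (m : V → ℝ) : Prop :=
  ∀ ε : ℝ, 0 < ε → ∃ f : V → ℝ, (Function.support f).Finite ∧
    (∀ x, |f x| ≤ 1) ∧ (∃ x, |f x| = 1) ∧
    -(∑ᶠ x, f x * lap w m f x * m x) < ε

open Classical in
/-- `∑_{x,y : f(y) < 0 ≤ f(x)} w(x,y)(f(x)-f(y))`. -/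
noncomputable def cutSum (w : V → V → ℝ) (f : V → ℝ) : ℝ :=
  ∑ᶠ p : V × V, if f p.2 < 0 ∧ 0 ≤ f p.1 then w p.1 p.2 * (f p.1 - f p.2) else 0

/-- Subexponential growth: `max_{B_r(x)} |u| = e^{o(r)}` as `r → ∞`. -/
def SubexpGrowth (d : V → V → ℝ) (x : V) (u : V → ℝ) : Prop :=
  Filter.Tendsto
    (fun r : ℕ => Real.log (sSup {c | ∃ y, d x y ≤ (r : ℝ) ∧ c = |u y|}) / (r : ℝ))
    Filter.atTop (nhds 0)


/-- The unnormalized Laplacian `∑_y w(x,y)(f(y)-f(x))`, that is, `m Δ f`. -/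
noncomputable def netFlow (w : V → V → ℝ) (f : V → ℝ) (x : V) : ℝ :=
  ∑ᶠ y, w x y * (f y - f x)

/-- The working hypotheses on a graph with its combinatorial distance `d`: symmetry, local
finiteness, existence of geodesics, finite balls, and non-negative curvature on edges. -/
structure CurvedGraph (w : V → V → ℝ) (m : V → ℝ) (d : V → V → ℝ) : Prop where
  symm : ∀ x y, w x y = w y x
  nonneg : ∀ x y, 0 ≤ w x y
  m_pos : ∀ x, 0 < m x
  locFin : LocallyFinite w
  dist_self : ∀ x, d x x = 0
  dist_comm : ∀ x y, d x y = d y x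
  dist_triangle : ∀ x y z, d x z ≤ d x y + d y z
  dist_nat : ∀ x y, ∃ n : ℕ, d x y = n
  dist_adj : ∀ x y, 0 < w x y → d x y = 1
  exists_step : ∀ x y, x ≠ y → ∃ z, 0 < w x z ∧ d z y = d x y - 1
  finite_ball : FiniteBalls d
  lap_le : ∀ f, Lip1 d f → ∀ x y, 0 < w x y → f y - f x = 1 → lap w m f y ≤ lap w m f x

theorem lap_eq (w : V → V → ℝ) (m f : V → ℝ) (x : V) :
    lap w m f x = (m x)⁻¹ * netFlow w f x := rfl

section CombDist

variable {w : V → V → ℝ} {m : V → ℝ}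

theorem exists_path_of_reflTransGen {x y : V}
    (h : Relation.ReflTransGen (fun a b => 0 < w a b) x y) :
    ∃ (n : ℕ) (p : ℕ → V), p 0 = x ∧ p n = y ∧ ∀ i < n, 0 < w (p i) (p (i + 1)) := by
  induction h with
  | refl => exact ⟨0, fun _ => x, rfl, rfl, by simp⟩
  | @tail b c _ hbc ih =>
    obtain ⟨n, p, h0, hn, hp⟩ := ih
    refine ⟨n + 1, fun i => if i ≤ n then p i else c, by simp [h0], by simp, ?_⟩
    intro i hi
    rcases Nat.lt_succ_iff_lt_or_eq.1 hi with h | h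
    · have h1 : i ≤ n := h.le
      have h2 : i + 1 ≤ n := h
      simpa [h1, h2] using hp i h
    · subst h
      simpa [hn] using hbc

theorem combDist_le {x y : V} (n : ℕ) (p : ℕ → V) (h0 : p 0 = x) (hn : p n = y)
    (hp : ∀ i < n, 0 < w (p i) (p (i + 1))) : combDist w x y ≤ n := by
  refine csInf_le ⟨0, ?_⟩ ⟨n, p, h0, hn, hp, rfl⟩
  rintro L ⟨k, q, -, -, -, rfl⟩
  positivity

theorem combDist_attained (hc : GraphConnected w) (x y : V) :
    ∃ (n : ℕ) (p : ℕ → V), p 0 = x ∧ p n = y ∧ (∀ i < n, 0 < w (p i) (p (i + 1))) ∧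
      combDist w x y = n := by
  classical
  have hex : ∃ n : ℕ, ∃ p : ℕ → V, p 0 = x ∧ p n = y ∧ ∀ i < n, 0 < w (p i) (p (i + 1)) :=
    exists_path_of_reflTransGen (hc x y)
  obtain ⟨p, h0, hn, hp⟩ := Nat.find_spec hex
  refine ⟨Nat.find hex, p, h0, hn, hp, le_antisymm (combDist_le _ p h0 hn hp) ?_⟩
  refine le_csInf ⟨_, _, p, h0, hn, hp, rfl⟩ ?_
  rintro L ⟨k, q, hq0, hqk, hq, rfl⟩
  exact_mod_cast Nat.find_min' hex ⟨q, hq0, hqk, hq⟩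

theorem netFlow_eq_sum (hn : ∀ x y, 0 ≤ w x y) (f : V → ℝ) (x : V)
    {U : Finset V} (hU : ∀ y, 0 < w x y → y ∈ U) :
    netFlow w f x = ∑ y ∈ U, w x y * (f y - f x) := by
  refine finsum_eq_sum_of_support_subset _ fun y hy => ?_
  refine hU y (lt_of_le_of_ne (hn x y) fun h => hy ?_)
  simp [← h]

theorem curvedGraph_of_salami (hB : IsGraphBase w m (combDist w))
    (hK : NonnegCurv w m (combDist w)) : CurvedGraph w m (combDist w) := by
  obtain ⟨-, hsymm, hnn, hdiag, hm, hlf, hc, ⟨hself, hpos, hcomm, htri, -⟩, hfin⟩ := hB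
  have hadj : ∀ x y, 0 < w x y → combDist w x y = 1 := by
    intro x y hxy
    have hne : x ≠ y := by
      rintro rfl
      simp [hdiag] at hxy
    have h1 : combDist w x y ≤ (1 : ℕ) :=
      combDist_le 1 (fun i => if i = 0 then x else y) (by simp) (by simp)
        (by intro i hi; obtain rfl : i = 0 := by omega
            simpa using hxy)
    obtain ⟨n, -, -, -, -, hn⟩ := combDist_attained hc x y
    have h2 := hpos x y hne
    rw [hn] at h1 h2 ⊢
    have h3 : n ≤ 1 := by exact_mod_cast h1
    have h4 : 0 < n := by exact_mod_cast h2
    have : n = 1 := by omega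
    simp [this]
  refine ⟨hsymm, hnn, hm, hlf, hself, hcomm, htri, fun x y => ?_, hadj, fun x y hne => ?_,
    hfin, fun f hf x y hxy hfxy => ?_⟩
  · obtain ⟨n, -, -, -, -, hn⟩ := combDist_attained hc x y
    exact ⟨n, hn⟩
  · obtain ⟨n, p, h0, hn, hp, hd⟩ := combDist_attained hc x y
    obtain _ | n := n
    · exact absurd (h0.symm.trans hn) hne
    refine ⟨p 1, by simpa [h0] using hp 0 (by omega), le_antisymm ?_ ?_⟩
    · have : combDist w (p 1) y ≤ n :=
        combDist_le n (fun i => p (i + 1)) rfl hn fun i hi => hp (i + 1) (by omega)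
      rw [hd]; push_cast; linarith
    · have h1 := htri x (p 1) y
      have h2 := hadj x (p 1) (by simpa [h0] using hp 0 (by omega))
      linarith
  · have hk := hK x y hxy
    have hd := hadj x y hxy
    have hbound : ∀ g, Lip1 (combDist w) g → ∀ z,
        |lap w m g z| ≤ (m z)⁻¹ * ∑ y ∈ (hlf z).toFinset, w z y := by
      intro g hg z
      rw [lap_eq, netFlow_eq_sum hnn g z (U := (hlf z).toFinset) (by simp), abs_mul,
        abs_of_pos (inv_pos.2 (hm z))]
      refine mul_le_mul_of_nonneg_left ?_ (inv_pos.2 (hm z)).le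
      refine (Finset.abs_sum_le_sum_abs _ _).trans (Finset.sum_le_sum fun y hy => ?_)
      have hzy : 0 < w z y := by simpa using hy
      rw [abs_mul, abs_of_pos hzy]
      have h1 := hg z y
      have h2 := hg y z
      rw [hcomm y z] at h2
      rw [hadj z y hzy] at h1 h2
      have : |g y - g z| ≤ 1 := abs_le.2 ⟨by linarith, h1⟩
      nlinarith
    unfold kappa at hk
    rw [hd, inv_one, one_mul] at hk
    have hle := csInf_le (s := {c | ∃ f : V → ℝ, Lip1 (combDist w) f ∧ f y - f x = 1 ∧
      c = lap w m f x - lap w m f y}) ?_ ⟨f, hf, hfxy, rfl⟩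
    · linarith
    · refine ⟨-((m x)⁻¹ * ∑ z ∈ (hlf x).toFinset, w x z) -
        ((m y)⁻¹ * ∑ z ∈ (hlf y).toFinset, w y z), ?_⟩
      rintro c ⟨g, hg, -, rfl⟩
      have h1 := (abs_le.1 (hbound g hg x)).1
      have h2 := (abs_le.1 (hbound g hg y)).2
      linarith

end CombDist

/-- `K` is finite and separates its complement into the two pieces `X` and `Y`. -/
structure Separates (w : V → V → ℝ) (X Y K : Set V) : Prop where
  cover : ∀ v, v ∈ X ∨ v ∈ Y ∨ v ∈ K
  disjXY : ∀ v, v ∈ X → v ∉ Y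
  disjXK : ∀ v, v ∈ X → v ∉ K
  disjYK : ∀ v, v ∈ Y → v ∉ K
  fin : K.Finite
  nonadj : ∀ x ∈ X, ∀ y ∈ Y, w x y = 0

/-- Lipschitz functions that are extremal outside `K`: every vertex of `X` lies on a
steepest ascent to `K`, and every vertex of `Y` on a steepest descent to `K`. -/
structure Extremal (d : V → V → ℝ) (X Y K : Set V) (f : V → ℝ) : Prop where
  lip : Lip1 d f
  up : ∀ x ∈ X, ∃ k ∈ K, f k - f x = d x k
  down : ∀ y ∈ Y, ∃ k ∈ K, f y - f k = d k y

theorem netFlow_neg (w : V → V → ℝ) (f : V → ℝ) (x : V) :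
    netFlow w (fun v => -f v) x = -netFlow w f x := by
  unfold netFlow
  rw [← finsum_neg_distrib]
  congr 1
  ext y
  ring

theorem lap_neg (w : V → V → ℝ) (m f : V → ℝ) (x : V) :
    lap w m (fun v => -f v) x = -lap w m f x := by
  rw [lap_eq, lap_eq, netFlow_neg, mul_neg]

namespace CurvedGraph

variable {w : V → V → ℝ} {m : V → ℝ} {d : V → V → ℝ}

theorem dist_nonneg (G : CurvedGraph w m d) (x y : V) : 0 ≤ d x y := by
  obtain ⟨n, hn⟩ := G.dist_nat x y
  rw [hn]; positivity

theorem one_le_dist (G : CurvedGraph w m d) {x y : V} (h : x ≠ y) : 1 ≤ d x y := by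
  obtain ⟨z, -, hz⟩ := G.exists_step x y h
  linarith [G.dist_nonneg z y]

theorem eq_of_dist_eq_zero (G : CurvedGraph w m d) {x y : V} (h : d x y = 0) : x = y := by
  by_contra hne
  linarith [G.one_le_dist hne]

theorem abs_sub_le (G : CurvedGraph w m d) {f : V → ℝ} (hf : Lip1 d f) (x y : V) :
    |f y - f x| ≤ d x y := by
  have h := hf y x
  rw [G.dist_comm] at h
  exact abs_le.2 ⟨by linarith, hf x y⟩

theorem adj_symm (G : CurvedGraph w m d) {x y : V} (h : 0 < w x y) : 0 < w y x := by
  rwa [G.symm]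

theorem netFlow_sum (G : CurvedGraph w m d) (f : V → ℝ) (x : V)
    {U : Finset V} (hU : ∀ y, 0 < w x y → y ∈ U) :
    netFlow w f x = ∑ y ∈ U, w x y * (f y - f x) :=
  netFlow_eq_sum G.nonneg f x hU

theorem netFlow_nbrs (G : CurvedGraph w m d) (f : V → ℝ) (x : V) :
    netFlow w f x = ∑ y ∈ (G.locFin x).toFinset, w x y * (f y - f x) :=
  G.netFlow_sum f x (by simp)

theorem netFlow_sub (G : CurvedGraph w m d) (f g : V → ℝ) (x : V) :
    netFlow w (fun v => f v - g v) x = netFlow w f x - netFlow w g x := by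
  simp only [G.netFlow_nbrs, ← Finset.sum_sub_distrib]
  exact Finset.sum_congr rfl fun y _ => by ring

theorem netFlow_add (G : CurvedGraph w m d) (f g : V → ℝ) (x : V) :
    netFlow w (fun v => f v + g v) x = netFlow w f x + netFlow w g x := by
  simp only [G.netFlow_nbrs, ← Finset.sum_add_distrib]
  exact Finset.sum_congr rfl fun y _ => by ring

theorem netFlow_eq_zero_iff (G : CurvedGraph w m d) (f : V → ℝ) (x : V) :
    lap w m f x = 0 ↔ netFlow w f x = 0 := by
  rw [lap_eq, mul_eq_zero, inv_eq_zero]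
  exact ⟨fun h => h.resolve_left (G.m_pos x).ne', Or.inr⟩

theorem lap_nonneg_iff (G : CurvedGraph w m d) (f : V → ℝ) (x : V) :
    0 ≤ lap w m f x ↔ 0 ≤ netFlow w f x := by
  rw [lap_eq]
  exact mul_nonneg_iff_of_pos_left (inv_pos.2 (G.m_pos x))

/-- Points at every intermediate distance on a geodesic. -/
theorem exists_between (G : CurvedGraph w m d) (x y : V) (j : ℕ) (hj : (j : ℝ) ≤ d x y) :
    ∃ z, d x z = j ∧ d z y = d x y - j := by
  induction j generalizing x with
  | zero => exact ⟨x, by simp [G.dist_self]⟩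
  | succ j ih =>
    push_cast at hj
    have hne : x ≠ y := by
      rintro rfl
      rw [G.dist_self] at hj
      linarith [j.cast_nonneg (α := ℝ)]
    obtain ⟨z, hxz, hz⟩ := G.exists_step x y hne
    obtain ⟨u, hu1, hu2⟩ := ih z (by linarith)
    have h1 := G.dist_adj x z hxz
    refine ⟨u, ?_, by push_cast; linarith⟩
    push_cast
    have h2 := G.dist_triangle x z u
    have h3 := G.dist_triangle x u y
    linarith

/-- Induction along a geodesic. -/
theorem geodesic_induction (G : CurvedGraph w m d) (y : V) {p : V → Prop} (h0 : p y)
    (hs : ∀ x z, 0 < w x z → d z y = d x y - 1 → p z → p x) (x : V) : p x := by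
  obtain ⟨n, hn⟩ := G.dist_nat x y
  induction n generalizing x with
  | zero =>
    obtain rfl := G.eq_of_dist_eq_zero (by simpa using hn)
    exact h0
  | succ n ih =>
    have hne : x ≠ y := by
      rintro rfl
      rw [G.dist_self] at hn
      push_cast at hn
      linarith [n.cast_nonneg (α := ℝ)]
    obtain ⟨z, hxz, hz⟩ := G.exists_step x y hne
    exact hs x z hxz hz (ih z (by rw [hz, hn]; push_cast; ring))

theorem lap_le_of_tight (G : CurvedGraph w m d) {f : V → ℝ} (hf : Lip1 d f) {x y : V}
    (h : f y - f x = d x y) : lap w m f y ≤ lap w m f x := by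
  revert h
  refine G.geodesic_induction y (p := fun x => f y - f x = d x y → lap w m f y ≤ lap w m f x)
    (fun _ => le_rfl) (fun x z hxz hz ih h => ?_) x
  have h1 := hf x z
  have h2 := hf z y
  rw [G.dist_adj x z hxz] at h1
  exact (ih (by linarith)).trans (G.lap_le f hf x z hxz (by linarith))

/-- A property that spreads along edges holds everywhere once it holds somewhere. -/
theorem of_adj (G : CurvedGraph w m d) {p : V → Prop} (hs : ∀ x z, 0 < w x z → p z → p x)
    {y : V} (h0 : p y) (x : V) : p x :=
  G.geodesic_induction y h0 (fun x z h _ => hs x z h) x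

theorem exists_boundary_edge (G : CurvedGraph w m d) {A : Set V} {x y : V} (hx : x ∈ A)
    (hy : y ∉ A) : ∃ a ∈ A, ∃ b, b ∉ A ∧ 0 < w a b := by
  by_contra! hcon
  refine hy (G.of_adj (p := (· ∈ A)) (fun u v huv hv => ?_) hx y)
  by_contra hu
  exact absurd (hcon v hv u hu) (not_le.2 (G.adj_symm huv))

theorem exists_crossing (G : CurvedGraph w m d) {X Y K : Set V} (S : Separates w X Y K)
    {p q : V} (hp : p ∈ X) (hq : q ∈ Y) : ∃ k ∈ K, d p q = d p k + d k q := by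
  revert hp
  refine G.geodesic_induction q (p := fun p => p ∈ X → ∃ k ∈ K, d p q = d p k + d k q)
    (fun h => absurd hq (S.disjXY q h)) (fun x z hxz hz ih hx => ?_) p
  have h1 := G.dist_adj x z hxz
  rcases S.cover z with h | h | h
  · obtain ⟨k, hk, hkd⟩ := ih h
    refine ⟨k, hk, le_antisymm (G.dist_triangle _ _ _) ?_⟩
    linarith [G.dist_triangle x z k]
  · exact absurd hxz (by simp [S.nonadj x hx z h])
  · exact ⟨z, h, by linarith⟩

end CurvedGraph

theorem Separates.swap {w : V → V → ℝ} (hw : ∀ x y, w x y = w y x) {X Y K : Set V}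
    (S : Separates w X Y K) : Separates w Y X K :=
  ⟨fun v => by have := S.cover v; tauto, fun v h h' => S.disjXY v h' h, S.disjYK, S.disjXK,
    S.fin, fun x hx y hy => by rw [hw]; exact S.nonadj y hy x hx⟩

theorem SalamiPartition.separates {w : V → V → ℝ} {m : V → ℝ} {X Y K : Set V}
    (P : SalamiPartition w m X Y K) : Separates w X Y K := by
  obtain ⟨h1, h2, h3, h4, h5, h6, -, -⟩ := P
  refine ⟨fun v => ?_, fun v h h' => Set.disjoint_left.1 h2 h h',
    fun v h h' => Set.disjoint_left.1 h3 h h', fun v h h' => Set.disjoint_left.1 h4 h h', h5, h6⟩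
  have : v ∈ X ∪ Y ∪ K := h1 ▸ Set.mem_univ v
  simp only [Set.mem_union] at this
  tauto

theorem SalamiPartition.swap {w : V → V → ℝ} {m : V → ℝ} (hw : ∀ x y, w x y = w y x)
    {X Y K : Set V} (P : SalamiPartition w m X Y K) : SalamiPartition w m Y X K := by
  obtain ⟨h1, h2, h3, h4, h5, h6, h7, h8⟩ := P
  exact ⟨by rw [Set.union_comm Y X]; exact h1, h2.symm, h4, h3, h5,
    fun x hx y hy => by rw [hw]; exact h6 y hy x hx, h8, h7⟩

theorem Extremal.neg {d : V → V → ℝ} (hd : ∀ x y, d x y = d y x) {X Y K : Set V} {f : V → ℝ}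
    (h : Extremal d X Y K f) : Extremal d Y X K (fun v => -f v) := by
  refine ⟨fun x y => ?_, fun x hx => ?_, fun y hy => ?_⟩
  · have := h.lip y x
    rw [hd y x] at this
    linarith
  · obtain ⟨k, hk, h1⟩ := h.down x hx
    exact ⟨k, hk, by rw [hd]; linarith⟩
  · obtain ⟨k, hk, h1⟩ := h.up y hy
    exact ⟨k, hk, by rw [hd]; linarith⟩

theorem exists_uniform_slack {S : Set ℝ} (hS : S.Finite) :
    ∃ δ : ℝ, 0 < δ ∧ ∀ a ∈ S, ∀ n : ℤ, a + n < 0 → a + n ≤ -δ := by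
  have h : ∀ᶠ δ in nhdsWithin (0 : ℝ) (Set.Ioi 0), ∀ a ∈ S, δ < 1 - (a + ⌈-a⌉) := by
    refine (Set.Finite.eventually_all hS).2 fun a _ => ?_
    refine (gt_mem_nhds ?_).filter_mono nhdsWithin_le_nhds
    linarith [Int.ceil_lt_add_one (-a)]
  obtain ⟨δ, h1, h2⟩ := (h.and self_mem_nhdsWithin).exists
  refine ⟨δ, h2, fun a ha n hn => ?_⟩
  have h3 : n + 1 ≤ ⌈-a⌉ := by
    rw [Int.add_one_le_iff, Int.lt_ceil]
    linarith
  have h4 : (n : ℝ) + 1 ≤ ⌈-a⌉ := by exact_mod_cast h3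
  linarith [h1 a ha]

/-- No proper non-empty part of `K` is closed under taking neighbors in `K`. -/
def EdgeConnected (w : V → V → ℝ) (K : Set V) : Prop :=
  ∀ B ⊆ K, B.Nonempty → (∀ b ∈ B, ∀ k ∈ K, 0 < w b k → k ∈ B) → B = K

theorem Extremal.exists_anchor {w d : V → V → ℝ} {X Y K : Set V} {f : V → ℝ}
    (hE : Extremal d X Y K f) (S : Separates w X Y K) (hd : ∀ x y, ∃ n : ℕ, d x y = n) (v : V) :
    ∃ k ∈ K, ∃ n : ℤ, f v = f k + n := by
  rcases S.cover v with h | h | h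
  · obtain ⟨k, hk, h1⟩ := hE.up v h
    obtain ⟨n, hn⟩ := hd v k
    exact ⟨k, hk, -n, by push_cast; linarith⟩
  · obtain ⟨k, hk, h1⟩ := hE.down v h
    obtain ⟨n, hn⟩ := hd k v
    exact ⟨k, hk, n, by push_cast; linarith⟩
  · exact ⟨v, h, 0, by simp⟩

namespace CurvedGraph

variable {w : V → V → ℝ} {m : V → ℝ} {d : V → V → ℝ}

theorem netFlow_sub_indicator (G : CurvedGraph w m d) (f : V → ℝ) (A : Set V)
    [DecidablePred (· ∈ A)] (ε : ℝ) (x : V) :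
    netFlow w (fun v => f v - if v ∈ A then ε else 0) x =
      netFlow w f x + ε * ∑ y ∈ (G.locFin x).toFinset,
        w x y * ((if x ∈ A then 1 else 0) - if y ∈ A then 1 else 0) := by
  rw [G.netFlow_nbrs, G.netFlow_nbrs, Finset.mul_sum, ← Finset.sum_add_distrib]
  refine Finset.sum_congr rfl fun y _ => ?_
  split_ifs <;> ring

/-- Lowering an extremal function on the set reached by steepest ascents from the minimizers
of the Laplacian on `K` strictly shrinks the set of minimizers. -/
theorem exists_lowering (G : CurvedGraph w m d) {X Y K : Set V} (S : Separates w X Y K)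
    (hconn : EdgeConnected w K) {f : V → ℝ} (hE : Extremal d X Y K f) {c : ℝ}
    (hc : ∀ k ∈ K, c ≤ lap w m f k) (hb : ∃ b ∈ K, lap w m f b = c)
    (hk : ∃ k ∈ K, lap w m f k ≠ c) :
    ∃ f', Extremal d X Y K f' ∧ (∀ k ∈ K, c ≤ lap w m f' k) ∧
      {k ∈ K | lap w m f' k = c} ⊂ {k ∈ K | lap w m f k = c} := by
  classical
  set B : Set V := {k ∈ K | lap w m f k = c} with hB
  set A : Set V := {q | ∃ b ∈ B, f q - f b = d b q} ∪
    {x | x ∈ X ∧ ∀ k ∈ K, f k - f x = d x k → k ∈ B} with hA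
  have hBA : ∀ b ∈ B, b ∈ A := fun b hb => Or.inl ⟨b, hb, by simp [G.dist_self]⟩
  have hclosed : ∀ p ∈ A, ∀ q, f q - f p = d p q → q ∈ A := by
    have key : ∀ a b c, f b - f a = d a b → f c - f b = d b c → f c - f a = d a c := by
      intro a b c h1 h2
      linarith [hE.lip a c, G.dist_triangle a b c]
    rintro p (⟨b, hb, hbp⟩ | ⟨hpX, hp⟩) q hpq
    · exact Or.inl ⟨b, hb, key _ _ _ hbp hpq⟩
    · rcases S.cover q with h | h | h
      · exact Or.inr ⟨h, fun k hk hkq => hp k hk (key _ _ _ hpq hkq)⟩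
      · obtain ⟨k, hk, hkd⟩ := G.exists_crossing S hpX h
        have h1 := hE.lip p k
        have h2 := hE.lip k q
        exact Or.inl ⟨k, hp k hk (by linarith), by linarith⟩
      · exact hBA _ (hp q h hpq)
  have hAK : ∀ k ∈ K, k ∈ A → k ∈ B := by
    rintro k hk (⟨b, hb, hbk⟩ | ⟨hkX, -⟩)
    · exact ⟨hk, le_antisymm ((G.lap_le_of_tight hE.lip hbk).trans hb.2.le) (hc k hk)⟩
    · exact absurd hk (S.disjXK k hkX)
  obtain ⟨δ, hδ, hslack⟩ := exists_uniform_slack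
    ((S.fin.prod S.fin).image fun p : V × V => f p.1 - f p.2)
  have hgap : ∀ p q, f q - f p ≠ d p q → f q - f p ≤ d p q - δ := by
    intro p q hne
    obtain ⟨k, hk, n, hn⟩ := hE.exists_anchor S G.dist_nat q
    obtain ⟨k', hk', n', hn'⟩ := hE.exists_anchor S G.dist_nat p
    obtain ⟨j, hj⟩ := G.dist_nat p q
    have hlt := lt_of_le_of_ne (hE.lip p q) hne
    have := hslack (f k - f k') ⟨(k, k'), ⟨hk, hk'⟩, rfl⟩ (n - n' - j)
      (by push_cast; linarith)
    push_cast at this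
    linarith
  have hsmall : ∀ᶠ ε in nhdsWithin (0 : ℝ) (Set.Ioi 0), ∀ k ∈ K \ B,
      c < (m k)⁻¹ * (netFlow w f k + ε * ∑ y ∈ (G.locFin k).toFinset,
        w k y * ((if k ∈ A then 1 else 0) - if y ∈ A then 1 else 0)) := by
    refine (Set.Finite.eventually_all (S.fin.subset Set.sdiff_subset)).2 fun k hk => ?_
    have hlt : c < lap w m f k := lt_of_le_of_ne (hc k hk.1) fun h => hk.2 ⟨hk.1, h.symm⟩
    have hcont : Continuous fun ε : ℝ => (m k)⁻¹ * (netFlow w f k +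
        ε * ∑ y ∈ (G.locFin k).toFinset,
          w k y * ((if k ∈ A then 1 else 0) - if y ∈ A then 1 else 0)) := by fun_prop
    refine ((hcont.tendsto 0).eventually (lt_mem_nhds ?_)).filter_mono nhdsWithin_le_nhds
    simpa [lap_eq] using hlt
  obtain ⟨ε, ⟨hε1, hε2⟩, hε⟩ := ((hsmall.and
    ((gt_mem_nhds hδ).filter_mono nhdsWithin_le_nhds)).and self_mem_nhdsWithin).exists
  have hε : 0 < ε := hε
  have hout : ∀ k ∈ K \ B, c < lap w m (fun v => f v - if v ∈ A then ε else 0) k := by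
    intro k hk
    rw [lap_eq, G.netFlow_sub_indicator]
    exact hε1 k hk
  have hterm : ∀ b ∈ B, ∀ y,
      0 ≤ w b y * ((if b ∈ A then (1 : ℝ) else 0) - if y ∈ A then 1 else 0) := by
    intro b hb y
    refine mul_nonneg (G.nonneg _ _) ?_
    rw [if_pos (hBA b hb)]
    split_ifs <;> norm_num
  have hin : ∀ b ∈ B, c ≤ lap w m (fun v => f v - if v ∈ A then ε else 0) b := by
    intro b hb
    rw [lap_eq, G.netFlow_sub_indicator, mul_add, ← lap_eq, hb.2]
    have h1 := Finset.sum_nonneg fun y (_ : y ∈ (G.locFin b).toFinset) => hterm b hb y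
    have h2 := inv_pos.2 (G.m_pos b)
    have : 0 ≤ (m b)⁻¹ * (ε * ∑ y ∈ (G.locFin b).toFinset,
        w b y * ((if b ∈ A then (1 : ℝ) else 0) - if y ∈ A then 1 else 0)) := by positivity
    linarith
  have hall : ∀ k ∈ K, c ≤ lap w m (fun v => f v - if v ∈ A then ε else 0) k := fun k hk =>
    if h : k ∈ B then hin k h else (hout k ⟨hk, h⟩).le
  refine ⟨fun v => f v - if v ∈ A then ε else 0, ⟨fun p q => ?_, fun x hx => ?_,
    fun y hy => ?_⟩, hall, ?_⟩
  · have hlip := hE.lip p q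
    by_cases hp : p ∈ A <;> by_cases hq : q ∈ A <;> simp only [hp, hq, if_true, if_false]
    · linarith
    · have := hgap p q fun h => hq (hclosed p hp q h)
      linarith
    · linarith
    · linarith
  · by_cases hxA : x ∈ A
    · obtain ⟨k, hk, hkx⟩ := hE.up x hx
      refine ⟨k, hk, ?_⟩
      simp only [hxA, hclosed x hxA k hkx, if_true]
      linarith
    · have : ∃ k ∈ K, f k - f x = d x k ∧ k ∉ B := by
        by_contra! hcon
        exact hxA (Or.inr ⟨hx, hcon⟩)
      obtain ⟨k, hk, hkx, hkB⟩ := this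
      refine ⟨k, hk, ?_⟩
      have : k ∉ A := fun h => hkB (hAK k hk h)
      simp only [hxA, this, if_false]
      linarith
  · by_cases hyA : y ∈ A
    · rcases hyA with ⟨b, hb, hby⟩ | ⟨hyX, -⟩
      · refine ⟨b, hb.1, ?_⟩
        have h1 : y ∈ A := Or.inl ⟨b, hb, hby⟩
        simp only [h1, hBA b hb, if_true]
        linarith
      · exact absurd hy (S.disjXY y hyX)
    · obtain ⟨k, hk, hky⟩ := hE.down y hy
      have : k ∉ A := fun h => hyA (hclosed k h y hky)
      refine ⟨k, hk, ?_⟩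
      simp only [hyA, this, if_false]
      linarith
  · refine (Set.ssubset_iff_of_subset ?_).2 ?_
    · rintro k ⟨hk, hkc⟩
      by_contra hkB
      exact (hout k ⟨hk, hkB⟩).ne' hkc
    · obtain ⟨b0, hb0, hb0c⟩ := hb
      obtain ⟨k0, hk0, hk0c⟩ := hk
      have : ∃ b ∈ B, ∃ k ∈ K, 0 < w b k ∧ k ∉ B := by
        by_contra! hcon
        have := hconn B (fun k hk => hk.1) ⟨b0, hb0, hb0c⟩ hcon
        rw [← this] at hk0
        exact hk0c hk0.2
      obtain ⟨b, hb, k, hk, hbk, hkB⟩ := this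
      refine ⟨b, hb, fun h => ?_⟩
      have h1 := h.2
      have hkA : k ∉ A := fun h => hkB (hAK k hk h)
      rw [lap_eq, G.netFlow_sub_indicator, mul_add, ← lap_eq, hb.2] at h1
      have h2 : 0 < ∑ y ∈ (G.locFin b).toFinset,
          w b y * ((if b ∈ A then (1 : ℝ) else 0) - if y ∈ A then 1 else 0) := by
        refine Finset.sum_pos' (fun y _ => hterm b hb y) ⟨k, by simpa using hbk, ?_⟩
        rw [if_pos (hBA b hb), if_neg hkA]
        simpa using hbk
      have h3 := inv_pos.2 (G.m_pos b)
      have : 0 < (m b)⁻¹ * (ε * ∑ y ∈ (G.locFin b).toFinset,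
        w b y * ((if b ∈ A then (1 : ℝ) else 0) - if y ∈ A then 1 else 0)) := by positivity
      linarith

theorem exists_lap_gt (G : CurvedGraph w m d) {X Y K : Set V} (S : Separates w X Y K)
    (hconn : EdgeConnected w K) {f : V → ℝ} (hE : Extremal d X Y K f) {c : ℝ}
    (hc : ∀ k ∈ K, c ≤ lap w m f k) (hk : ∃ k ∈ K, lap w m f k ≠ c) :
    ∃ f', Extremal d X Y K f' ∧ ∀ k ∈ K, c < lap w m f' k := by
  induction hn : {k ∈ K | lap w m f k = c}.ncard using Nat.strong_induction_on
    generalizing f with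
  | _ n ih =>
    by_cases hb : ∃ b ∈ K, lap w m f b = c
    · obtain ⟨f', hE', hc', hss⟩ := G.exists_lowering S hconn hE hc hb hk
      have hlt := Set.ncard_lt_ncard hss (S.fin.subset (Set.sep_subset _ _))
      obtain ⟨b, hbB, hb'⟩ := Set.exists_of_ssubset hss
      exact ih _ (hn ▸ hlt) hE' hc' ⟨b, hbB.1, fun h => hb' ⟨hbB.1, h⟩⟩ rfl
    · push Not at hb
      exact ⟨f, hE, fun k hk => lt_of_le_of_ne (hc k hk) (hb k hk).symm⟩

end CurvedGraph

theorem netFlow_const (w : V → V → ℝ) (c : ℝ) (x : V) : netFlow w (fun _ => c) x = 0 := by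
  simp [netFlow]

theorem Extremal.sub_const {d : V → V → ℝ} {X Y K : Set V} {f : V → ℝ}
    (h : Extremal d X Y K f) (c : ℝ) :
    Extremal d X Y K (fun v => f v - c) := by
  refine ⟨fun x y => ?_, fun x hx => ?_, fun y hy => ?_⟩
  · linarith [h.lip x y]
  · obtain ⟨k, hk, h1⟩ := h.up x hx
    exact ⟨k, hk, by linarith⟩
  · obtain ⟨k, hk, h1⟩ := h.down y hy
    exact ⟨k, hk, by linarith⟩

theorem lap_sub_const (w : V → V → ℝ) (m f : V → ℝ) (c : ℝ) (x : V) :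
    lap w m (fun v => f v - c) x = lap w m f x := by
  simp [lap]

namespace CurvedGraph

variable {w : V → V → ℝ} {m : V → ℝ} {d : V → V → ℝ}

theorem exists_closed_nbhd (G : CurvedGraph w m d) (A : Finset V) :
    ∃ U : Finset V, A ⊆ U ∧ ∀ x ∈ A, ∀ y, 0 < w x y → y ∈ U := by
  classical
  refine ⟨A ∪ A.biUnion fun x => (G.locFin x).toFinset, Finset.subset_union_left, ?_⟩
  intro x hx y hxy
  exact Finset.mem_union_right _ (Finset.mem_biUnion.2 ⟨x, hx, by simpa using hxy⟩)

/-- Green's identity on a finite set. -/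
theorem green (G : CurvedGraph w m d) [DecidableEq V] {A U : Finset V} (hAU : A ⊆ U)
    (hU : ∀ x ∈ A, ∀ y, 0 < w x y → y ∈ U) (η θ : V → ℝ) :
    ∑ x ∈ A, (η x * netFlow w θ x - θ x * netFlow w η x) =
      ∑ x ∈ A, ∑ y ∈ U \ A, w x y * (η x * θ y - θ x * η y) := by
  have h1 : ∀ x ∈ A, η x * netFlow w θ x - θ x * netFlow w η x =
      ∑ y ∈ U \ A, w x y * (η x * θ y - θ x * η y) +
        ∑ y ∈ A, w x y * (η x * θ y - θ x * η y) := by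
    intro x hx
    rw [Finset.sum_sdiff hAU, G.netFlow_sum θ x (hU x hx), G.netFlow_sum η x (hU x hx),
      Finset.mul_sum, Finset.mul_sum, ← Finset.sum_sub_distrib]
    exact Finset.sum_congr rfl fun y _ => by ring
  rw [Finset.sum_congr rfl h1, Finset.sum_add_distrib]
  have h2 : ∑ x ∈ A, ∑ y ∈ A, w x y * (η x * θ y - θ x * η y) =
      -∑ x ∈ A, ∑ y ∈ A, w x y * (η x * θ y - θ x * η y) := by
    conv_lhs => rw [Finset.sum_comm]
    rw [← Finset.sum_neg_distrib]
    refine Finset.sum_congr rfl fun x _ => ?_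
    rw [← Finset.sum_neg_distrib]
    refine Finset.sum_congr rfl fun y _ => ?_
    rw [G.symm y x]
    ring
  linarith

theorem sum_netFlow (G : CurvedGraph w m d) [DecidableEq V] {A U : Finset V} (hAU : A ⊆ U)
    (hU : ∀ x ∈ A, ∀ y, 0 < w x y → y ∈ U) (θ : V → ℝ) :
    ∑ x ∈ A, netFlow w θ x = ∑ x ∈ A, ∑ y ∈ U \ A, w x y * (θ y - θ x) := by
  simpa [netFlow_const] using G.green hAU hU (fun _ => 1) θ

theorem finite_superlevel (G : CurvedGraph w m d) {X Y K : Set V} (S : Separates w X Y K)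
    {f : V → ℝ} (hE : Extremal d X Y K f) (t : ℝ) : {x | x ∈ X ∧ t ≤ f x}.Finite := by
  refine (S.fin.biUnion fun k _ => G.finite_ball k (f k - t)).subset ?_
  rintro x ⟨hx, ht⟩
  obtain ⟨k, hk, hkx⟩ := hE.up x hx
  refine Set.mem_biUnion hk ?_
  rw [Set.mem_ofPred_eq, G.dist_comm]
  linarith

/-- The total flow of an extremal function down out of a superlevel set in `X` is bounded. -/
theorem exists_superlevel_flow_bound [DecidableEq V] (G : CurvedGraph w m d) {X Y K : Set V}
    (S : Separates w X Y K) :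
    ∃ C, 0 ≤ C ∧ ∀ f, Lip1 d f → ∀ t, ∀ A U : Finset V,
      (∀ x, x ∈ A ↔ x ∈ X ∧ t ≤ f x) → A ⊆ U → (∀ x ∈ A, ∀ y, 0 < w x y → y ∈ U) →
      ∑ x ∈ A, netFlow w f x + ∑ x ∈ A, ∑ y ∈ U \ A, w x y * max 0 (f x - f y) ≤ C := by
  classical
  refine ⟨∑ k ∈ S.fin.toFinset, ∑ y ∈ (G.locFin k).toFinset, w k y,
    Finset.sum_nonneg fun k _ => Finset.sum_nonneg fun y _ => G.nonneg _ _, ?_⟩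
  intro f hf t A U hA hAU hU
  rw [G.sum_netFlow hAU hU, ← Finset.sum_add_distrib]
  have h1 : ∀ x ∈ A, ∑ y ∈ U \ A, w x y * (f y - f x) +
      ∑ y ∈ U \ A, w x y * max 0 (f x - f y) ≤ ∑ k ∈ S.fin.toFinset, w x k := by
    intro x hx
    have hxA := (hA x).1 hx
    rw [← Finset.sum_add_distrib]
    have h2 : ∀ y ∈ U \ A, w x y * (f y - f x) + w x y * max 0 (f x - f y) ≤
        if y ∈ K then w x y else 0 := by
      intro y hy
      have hyA : y ∉ A := (Finset.mem_sdiff.1 hy).2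
      rcases (G.nonneg x y).eq_or_lt with h0 | h0
      · rw [← h0]; simp
      have h3 := hf x y
      rw [G.dist_adj x y h0] at h3
      rcases S.cover y with h | h | h
      · have : f y < t := by
          by_contra! hc
          exact hyA ((hA y).2 ⟨h, hc⟩)
        rw [if_neg (S.disjXK y h), max_eq_right (by linarith)]
        linarith
      · exact absurd h0 (by simp [S.nonadj x hxA.1 y h])
      · rw [if_pos h, ← mul_add]
        refine mul_le_of_le_one_right (G.nonneg _ _) ?_
        rcases le_total 0 (f x - f y) with h4 | h4
        · rw [max_eq_right h4]; linarith
        · rw [max_eq_left h4]; linarith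
    refine (Finset.sum_le_sum h2).trans ?_
    rw [← Finset.sum_filter]
    refine Finset.sum_le_sum_of_subset_of_nonneg ?_ fun y _ _ => G.nonneg _ _
    intro y hy
    simpa using (Finset.mem_filter.1 hy).2
  refine (Finset.sum_le_sum h1).trans ?_
  rw [Finset.sum_comm]
  refine Finset.sum_le_sum fun k _ => ?_
  have h5 : ∑ x ∈ A, w x k = ∑ x ∈ A.filter (0 < w k ·), w k x := by
    rw [Finset.sum_filter]
    refine Finset.sum_congr rfl fun x _ => ?_
    split_ifs with h
    · exact G.symm _ _
    · rw [G.symm]; exact le_antisymm (not_lt.1 h) (G.nonneg _ _)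
  rw [h5]
  refine Finset.sum_le_sum_of_subset_of_nonneg ?_ fun y _ _ => G.nonneg _ _
  intro y hy
  simpa using (Finset.mem_filter.1 hy).2

theorem not_lap_pos (G : CurvedGraph w m d) {X Y K : Set V} (S : Separates w X Y K)
    (hX : InfVolume m X) {f : V → ℝ} (hE : Extremal d X Y K f) {c : ℝ} (hc : 0 < c)
    (h : ∀ k ∈ K, c ≤ lap w m f k) : False := by
  classical
  obtain ⟨C, hC, hflow⟩ := G.exists_superlevel_flow_bound S
  obtain ⟨F, hFX, hF⟩ := hX (C / c)
  obtain ⟨t, ht⟩ : ∃ t, ∀ x ∈ F, t ≤ f x := by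
    obtain ⟨t, ht⟩ := (F.finite_toSet.image f).bddBelow
    exact ⟨t, fun x hx => ht ⟨x, hx, rfl⟩⟩
  have hfin := G.finite_superlevel S hE t
  obtain ⟨U, hAU, hU⟩ := G.exists_closed_nbhd hfin.toFinset
  have h1 := hflow f hE.lip t hfin.toFinset U (by simp) hAU hU
  have h2 : 0 ≤ ∑ x ∈ hfin.toFinset, ∑ y ∈ U \ hfin.toFinset,
      w x y * max 0 (f x - f y) := Finset.sum_nonneg fun x _ => Finset.sum_nonneg fun y _ =>
    mul_nonneg (G.nonneg _ _) (le_max_left _ _)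
  have hlow : ∀ x ∈ X, c * m x ≤ netFlow w f x := by
    intro x hx
    obtain ⟨k, hk, hkx⟩ := hE.up x hx
    have h3 := (h k hk).trans (G.lap_le_of_tight hE.lip hkx)
    rwa [lap_eq, inv_mul_eq_div, le_div_iff₀ (G.m_pos x)] at h3
  have h4 : c * ∑ x ∈ F, m x ≤ ∑ x ∈ hfin.toFinset, netFlow w f x := by
    rw [Finset.mul_sum]
    refine (Finset.sum_le_sum fun x hx => hlow x (hFX hx)).trans
      (Finset.sum_le_sum_of_subset_of_nonneg ?_ fun x hx _ => ?_)
    · intro x hx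
      simpa using ⟨hFX hx, ht x hx⟩
    · have hxX : x ∈ X := ((Set.Finite.mem_toFinset _).1 hx).1
      exact le_trans (mul_nonneg hc.le (G.m_pos x).le) (hlow x hxX)
  rw [div_lt_iff₀ hc] at hF
  linarith

/-- Extremal extension of a Lipschitz function on `K`. -/
theorem exists_extension (G : CurvedGraph w m d) {X Y K : Set V} (S : Separates w X Y K)
    (hne : K.Nonempty) {f : V → ℝ} (hf : Lip1On d K f) :
    ∃ ψ, Extremal d X Y K ψ ∧ ∀ k ∈ K, ψ k = f k := by
  classical
  have hval : ∀ v, ∃ a : ℝ,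
      (v ∉ Y → ∃ k ∈ K, a = f k - d v k) ∧ (v ∉ X → ∃ k ∈ K, a = f k + d v k) ∧
      ∀ k ∈ K, f k - d v k ≤ a ∧ a ≤ f k + d v k := by
    have hcross : ∀ v, ∀ k ∈ K, ∀ k' ∈ K, f k - d v k ≤ f k' + d v k' := by
      intro v k hk k' hk'
      have h1 := hf k' hk' k hk
      have h2 := G.dist_triangle k' v k
      rw [G.dist_comm k' v] at h2
      linarith
    intro v
    by_cases hK : v ∈ K
    · refine ⟨f v, fun _ => ⟨v, hK, by simp [G.dist_self]⟩,
        fun _ => ⟨v, hK, by simp [G.dist_self]⟩, fun k hk => ?_⟩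
      have h1 := hcross v k hk v hK
      have h2 := hcross v v hK k hk
      rw [G.dist_self] at h1 h2
      exact ⟨by linarith, by linarith⟩
    by_cases hX : v ∈ X
    · obtain ⟨k, hk, hmax⟩ := Set.exists_max_image K (fun k => f k - d v k) S.fin hne
      exact ⟨f k - d v k, fun _ => ⟨k, hk, rfl⟩, fun h => absurd hX h,
        fun k' hk' => ⟨hmax k' hk', hcross v k hk k' hk'⟩⟩
    · obtain ⟨k, hk, hmin⟩ := Set.exists_min_image K (fun k => f k + d v k) S.fin hne
      exact ⟨f k + d v k, fun h => by have := S.cover v; tauto, fun _ => ⟨k, hk, rfl⟩,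
        fun k' hk' => ⟨hcross v k' hk' k hk, hmin k' hk'⟩⟩
  choose ψ h1 h2 h3 using hval
  have hK : ∀ k ∈ K, ψ k = f k := by
    intro k hk
    have := h3 k k hk
    rw [G.dist_self] at this
    linarith
  refine ⟨ψ, ⟨fun p q => ?_, fun x hx => ?_, fun y hy => ?_⟩, hK⟩
  · by_cases hq : q ∈ Y
    · by_cases hp : p ∈ X
      · obtain ⟨k, hk, hkd⟩ := G.exists_crossing S hp hq
        have h4 := h3 p k hk
        have h5 := h3 q k hk
        rw [G.dist_comm q k] at h5
        linarith
      · obtain ⟨k, hk, hkp⟩ := h2 p hp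
        have h5 := h3 q k hk
        have h6 := G.dist_triangle q p k
        rw [G.dist_comm q p] at h6
        linarith
    · obtain ⟨k, hk, hkq⟩ := h1 q hq
      have h5 := h3 p k hk
      have h6 := G.dist_triangle p q k
      linarith
  · obtain ⟨k, hk, hkx⟩ := h1 x (S.disjXY x hx)
    exact ⟨k, hk, by rw [hK k hk]; linarith⟩
  · obtain ⟨k, hk, hky⟩ := h2 y fun h => S.disjXY y h hy
    exact ⟨k, hk, by rw [hK k hk, G.dist_comm]; linarith⟩

theorem continuous_lap (G : CurvedGraph w m d) (x : V) :
    Continuous fun f : V → ℝ => lap w m f x := by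
  simp only [lap_eq, G.netFlow_nbrs]
  fun_prop

theorem isCompact_extremal (G : CurvedGraph w m d) {X Y K : Set V} (hK : K.Finite) (x₀ : V) :
    IsCompact {f | Extremal d X Y K f ∧ f x₀ = 0} := by
  have hcl : IsClosed {f | Extremal d X Y K f ∧ f x₀ = 0} := by
    have heq : {f | Extremal d X Y K f ∧ f x₀ = 0} =
        (⋂ x, ⋂ y, {f : V → ℝ | f y - f x ≤ d x y}) ∩
        (⋂ x ∈ X, ⋃ k ∈ K, {f : V → ℝ | f k - f x = d x k}) ∩
        (⋂ y ∈ Y, ⋃ k ∈ K, {f : V → ℝ | f y - f k = d k y}) ∩ {f | f x₀ = 0} := by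
      ext f
      simp only [Set.mem_ofPred_eq, Set.mem_inter_iff, Set.mem_iInter, Set.mem_iUnion, exists_prop]
      exact ⟨fun ⟨⟨h1, h2, h3⟩, h4⟩ => ⟨⟨⟨h1, h2⟩, h3⟩, h4⟩,
        fun ⟨⟨⟨h1, h2⟩, h3⟩, h4⟩ => ⟨⟨h1, h2, h3⟩, h4⟩⟩
    rw [heq]
    refine ((IsClosed.inter ?_ ?_).inter ?_).inter ?_
    · exact isClosed_iInter fun x => isClosed_iInter fun y =>
        isClosed_le (by fun_prop) (by fun_prop)
    · exact isClosed_biInter fun x _ => hK.isClosed_biUnion fun k _ =>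
        isClosed_eq (by fun_prop) (by fun_prop)
    · exact isClosed_biInter fun x _ => hK.isClosed_biUnion fun k _ =>
        isClosed_eq (by fun_prop) (by fun_prop)
    · exact isClosed_eq (by fun_prop) (by fun_prop)
  refine (isCompact_univ_pi fun v => isCompact_Icc (a := -d x₀ v) (b := d x₀ v)).of_isClosed_subset
    hcl ?_
  rintro f ⟨hE, h0⟩ v -
  have := G.abs_sub_le hE.lip x₀ v
  rw [h0, sub_zero] at this
  exact abs_le.1 this

theorem lap_eq_zero_of_nonneg (G : CurvedGraph w m d) {X Y K : Set V} (S : Separates w X Y K)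
    (hX : InfVolume m X) (hconn : EdgeConnected w K) {f : V → ℝ} (hE : Extremal d X Y K f)
    (h : ∀ k ∈ K, 0 ≤ lap w m f k) : ∀ k ∈ K, lap w m f k = 0 := by
  by_contra! hcon
  obtain ⟨f', hE', hf'⟩ := G.exists_lap_gt S hconn hE h hcon
  obtain ⟨k, hk, -⟩ := hcon
  obtain ⟨k₁, hk₁, hmin⟩ := Set.exists_min_image K (lap w m f') S.fin ⟨k, hk⟩
  exact G.not_lap_pos S hX hE' (hf' k₁ hk₁) hmin

theorem exists_lap_eq_zero (G : CurvedGraph w m d) {X Y K : Set V}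
    (P : SalamiPartition w m X Y K) (hconn : EdgeConnected w K) (hne : K.Nonempty) :
    ∃ f, Extremal d X Y K f ∧ ∀ k ∈ K, lap w m f k = 0 := by
  have S := P.separates
  obtain ⟨x₀, hx₀⟩ := id hne
  have hneF : S.fin.toFinset.Nonempty := by simpa using hne
  have hcont : Continuous fun f : V → ℝ => S.fin.toFinset.inf' hneF fun k => lap w m f k :=
    Continuous.finset_inf'_apply _ fun k _ => G.continuous_lap k
  obtain ⟨f₀, hf₀, -⟩ := G.exists_extension S hne (f := fun _ => 0)
    fun x _ y _ => by simpa using G.dist_nonneg x y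
  obtain ⟨f, ⟨hE, h0⟩, hmax⟩ := (G.isCompact_extremal (X := X) (Y := Y) S.fin x₀).exists_isMaxOn
    ⟨_, hf₀.sub_const (f₀ x₀), sub_self _⟩ hcont.continuousOn
  set c := S.fin.toFinset.inf' hneF fun k => lap w m f k with hc
  have hle : ∀ k ∈ K, c ≤ lap w m f k := fun k hk => Finset.inf'_le _ (by simpa using hk)
  have heq : ∀ k ∈ K, lap w m f k = c := by
    by_contra! hcon
    obtain ⟨f', hE', hf'⟩ := G.exists_lap_gt S hconn hE hle hcon
    have h1 : (S.fin.toFinset.inf' hneF fun k => lap w m (fun v => f' v - f' x₀) k) ≤ c :=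
      hmax ⟨hE'.sub_const (f' x₀), sub_self _⟩
    simp only [lap_sub_const] at h1
    have h2 : c < S.fin.toFinset.inf' hneF fun k => lap w m f' k :=
      (Finset.lt_inf'_iff _).2 fun k hk => hf' k (by simpa using hk)
    exact absurd h1 (not_le.2 h2)
  have hX : InfVolume m X := P.2.2.2.2.2.2.1
  have hY : InfVolume m Y := P.2.2.2.2.2.2.2
  have h1 : c ≤ 0 := by
    by_contra! hpos
    exact G.not_lap_pos S hX hE hpos hle
  have h2 : 0 ≤ c := by
    by_contra! hneg
    refine G.not_lap_pos (S.swap G.symm) hY (hE.neg G.dist_comm) (neg_pos.2 hneg) fun k hk => ?_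
    rw [lap_neg, heq k hk]
  exact ⟨f, hE, fun k hk => by rw [heq k hk]; exact le_antisymm h1 h2⟩

theorem edgeConnected_of_starlike (G : CurvedGraph w m d) {K : Set V} {x₀ : V}
    (hK : ∀ v ∈ K, ∀ z, 0 < w v z → d z x₀ = d v x₀ - 1 → z ∈ K) : EdgeConnected w K := by
  have key : ∀ B ⊆ K, (∀ b ∈ B, ∀ k ∈ K, 0 < w b k → k ∈ B) → ∀ v, v ∈ K → (v ∈ B ↔ x₀ ∈ B) := by
    intro B hBK hB v
    refine G.geodesic_induction x₀ (p := fun v => v ∈ K → (v ∈ B ↔ x₀ ∈ B)) (fun _ => Iff.rfl)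
      (fun v z hvz hz ih hv => ?_) v
    have hzK := hK v hv z hvz hz
    rw [← ih hzK]
    exact ⟨fun h => hB v h z hzK hvz, fun h => hB z h v hv (G.adj_symm hvz)⟩
  intro B hBK ⟨b, hb⟩ hB
  have h0 := (key B hBK hB b (hBK hb)).1 hb
  exact Set.Subset.antisymm hBK fun v hv => (key B hBK hB v hv).2 h0

theorem infVolume_sdiff (G : CurvedGraph w m d) {X F : Set V} (hX : InfVolume m X)
    (hF : F.Finite) : InfVolume m (X \ F) := by
  classical
  intro c
  obtain ⟨A, hA, hsum⟩ := hX (c + ∑ x ∈ hF.toFinset, m x)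
  refine ⟨A \ hF.toFinset, fun x hx => ?_, ?_⟩
  · have := Finset.mem_sdiff.1 (Finset.mem_coe.1 hx)
    exact ⟨hA this.1, by simpa using this.2⟩
  · have h1 : ∑ x ∈ A, m x ≤ ∑ x ∈ A \ hF.toFinset ∪ hF.toFinset, m x := by
      refine Finset.sum_le_sum_of_subset_of_nonneg ?_ fun x _ _ => (G.m_pos x).le
      rw [Finset.sdiff_union_self_eq_union]
      exact Finset.subset_union_left
    rw [Finset.sum_union Finset.sdiff_disjoint] at h1
    linarith

theorem salamiPartition_of_cover (G : CurvedGraph w m d) {X Y K : Set V} (hK : K.Finite)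
    (hcov : ∀ v, v ∈ X ∨ v ∈ Y ∨ v ∈ K) (hd : ∀ v ∈ X, v ∉ Y) (hadj : ∀ x ∈ X, ∀ y ∈ Y, w x y = 0)
    (hX : InfVolume m X) (hY : InfVolume m Y) : SalamiPartition w m (X \ K) (Y \ K) K := by
  refine ⟨?_, ?_, Set.disjoint_sdiff_left, Set.disjoint_sdiff_left, hK,
    fun x hx y hy => hadj x hx.1 y hy.1, G.infVolume_sdiff hX hK, G.infVolume_sdiff hY hK⟩
  · ext v
    have := hcov v
    simp only [Set.mem_union, Set.mem_sdiff, Set.mem_univ, iff_true]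
    tauto
  · exact Set.disjoint_left.2 fun v h h' => hd v h.1 h'.1

theorem extremal_lap_eq_zero_left (G : CurvedGraph w m d) {X Y K : Set V}
    (P : SalamiPartition w m X Y K) {x₀ : V}
    (hK : ∀ v ∈ K, ∀ z, 0 < w v z → d z x₀ = d v x₀ - 1 → z ∈ K) {f : V → ℝ}
    (hE : Extremal d X Y K f) (h : ∀ k ∈ K, lap w m f k = 0) : ∀ x ∈ X, lap w m f x = 0 := by
  intro x hx
  have S := P.separates
  set K' : Set V := K ∪ {u | u ∈ X ∧ d x₀ u ≤ d x₀ x} with hK'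
  have hfin : {u | u ∈ X ∧ d x₀ u ≤ d x₀ x}.Finite :=
    (G.finite_ball x₀ (d x₀ x)).subset fun u hu => hu.2
  have S' : Separates w (X \ K') Y K' := by
    refine ⟨fun v => ?_, fun v hv => S.disjXY v hv.1, fun v hv => hv.2, fun v hv h => ?_,
      S.fin.union hfin, fun x hx y hy => S.nonadj x hx.1 y hy⟩
    · have := S.cover v
      simp only [Set.mem_sdiff, hK', Set.mem_union]
      tauto
    · rcases h with h | h
      · exact S.disjYK v hv h
      · exact S.disjXY v h.1 hv
  have hE' : Extremal d (X \ K') Y K' f := by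
    refine ⟨hE.lip, fun u hu => ?_, fun u hu => ?_⟩
    · obtain ⟨k, hk, hku⟩ := hE.up u hu.1
      exact ⟨k, Or.inl hk, hku⟩
    · obtain ⟨k, hk, hku⟩ := hE.down u hu
      exact ⟨k, Or.inl hk, hku⟩
  have hconn : EdgeConnected w K' := by
    refine G.edgeConnected_of_starlike (x₀ := x₀) ?_
    rintro v (hv | ⟨hvX, hv⟩) z hvz hz
    · exact Or.inl (hK v hv z hvz hz)
    · rcases S.cover z with h | h | h
      · rw [G.dist_comm z, G.dist_comm v] at hz
        exact Or.inr ⟨h, by linarith⟩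
      · exact absurd hvz (by simp [S.nonadj v hvX z h])
      · exact Or.inl h
  refine G.lap_eq_zero_of_nonneg S' (G.infVolume_sdiff P.2.2.2.2.2.2.1 S'.fin) hconn hE' ?_ x
    (Or.inr ⟨hx, le_rfl⟩)
  rintro k (hk | ⟨hk, -⟩)
  · exact (h k hk).ge
  · obtain ⟨k', hk', hkk⟩ := hE.up k hk
    rw [← h k' hk']
    exact G.lap_le_of_tight hE.lip hkk

/-- Existence of extremal harmonic functions. -/
theorem exists_harmonic_extremal (G : CurvedGraph w m d) {X Y : Set V} {x₀ : V} {R : ℝ}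
    (hR : 0 ≤ R) (P : SalamiPartition w m X Y {v | d x₀ v ≤ R}) :
    ∃ g, Extremal d X Y {v | d x₀ v ≤ R} g ∧ ∀ v, lap w m g v = 0 := by
  have hstar : ∀ v ∈ {v | d x₀ v ≤ R}, ∀ z, 0 < w v z → d z x₀ = d v x₀ - 1 →
      z ∈ {v | d x₀ v ≤ R} := by
    intro v hv z _ hz
    rw [G.dist_comm z, G.dist_comm v] at hz
    have : d x₀ v ≤ R := hv
    exact Set.mem_ofPred_eq ▸ (by linarith : d x₀ z ≤ R)
  obtain ⟨g, hE, hg⟩ := G.exists_lap_eq_zero P (G.edgeConnected_of_starlike hstar)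
    ⟨x₀, by simpa [G.dist_self] using hR⟩
  refine ⟨g, hE, fun v => ?_⟩
  rcases P.separates.cover v with h | h | h
  · exact G.extremal_lap_eq_zero_left P hstar hE hg v h
  · have := G.extremal_lap_eq_zero_left (P.swap G.symm) hstar (hE.neg G.dist_comm)
      (fun k hk => by rw [lap_neg, hg k hk, neg_zero]) v h
    rwa [lap_neg, neg_eq_zero] at this
  · exact hg v h

end CurvedGraph

/-- An extremal harmonic function on a salami whose edge weights are bounded below. -/
structure HarmonicProfile (w : V → V → ℝ) (m : V → ℝ) (d : V → V → ℝ) (X Y K : Set V)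
    (g : V → ℝ) : Prop where
  graph : CurvedGraph w m d
  part : SalamiPartition w m X Y K
  ext : Extremal d X Y K g
  harm : ∀ v, netFlow w g v = 0
  weight_low : ∃ ε, 0 < ε ∧ ∀ x y, 0 < w x y → ε ≤ w x y

namespace HarmonicProfile

variable {w : V → V → ℝ} {m : V → ℝ} {d : V → V → ℝ} {X Y K : Set V} {g : V → ℝ}

theorem neg (H : HarmonicProfile w m d X Y K g) :
    HarmonicProfile w m d Y X K (fun v => -g v) :=
  ⟨H.graph, H.part.swap H.graph.symm, H.ext.neg H.graph.dist_comm,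
    fun v => by rw [netFlow_neg, H.harm v, neg_zero], H.weight_low⟩

theorem abs_sub_le_one (H : HarmonicProfile w m d X Y K g) {x y : V} (h : 0 < w x y) :
    |g y - g x| ≤ 1 :=
  (H.graph.abs_sub_le H.ext.lip x y).trans (H.graph.dist_adj x y h).le

end HarmonicProfile

theorem CurvedGraph.exists_asymptotics {w : V → V → ℝ} {m : V → ℝ} {d : V → V → ℝ}
    (G : CurvedGraph w m d) {X Y K : Set V} (S : Separates w X Y K) {f : V → ℝ}
    (hE : Extremal d X Y K f) (x₀ : V) :
    ∃ M, 0 ≤ M ∧ (∀ v, v ∉ Y → |f v + d x₀ v| ≤ M) ∧ (∀ v, v ∉ X → |f v - d x₀ v| ≤ M) := by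
  obtain ⟨M, hM⟩ := (S.fin.image fun k => |f k| + d x₀ k).bddAbove
  have hM' : ∀ k ∈ K, |f k| + d x₀ k ≤ max 0 M := fun k hk =>
    (hM ⟨k, hk, rfl⟩).trans (le_max_right _ _)
  refine ⟨max 0 M, le_max_left _ _, fun v hv => ?_, fun v hv => ?_⟩
  · obtain ⟨k, hk, h⟩ : ∃ k ∈ K, f v = f k - d v k := by
      by_cases hX : v ∈ X
      · obtain ⟨k, hk, h⟩ := hE.up v hX
        exact ⟨k, hk, by linarith⟩
      · exact ⟨v, by have := S.cover v; tauto, by simp [G.dist_self]⟩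
    refine le_trans ?_ (hM' k hk)
    have h1 := G.dist_triangle x₀ k v
    have h2 := G.dist_triangle v x₀ k
    rw [G.dist_comm v x₀] at h2
    rw [G.dist_comm k v] at h1
    have h3 := G.dist_triangle x₀ v k
    have h4 := abs_le.1 (le_refl |f k|)
    rw [h, abs_le]
    constructor <;> linarith
  · obtain ⟨k, hk, h⟩ : ∃ k ∈ K, f v = f k + d v k := by
      by_cases hY : v ∈ Y
      · obtain ⟨k, hk, h⟩ := hE.down v hY
        exact ⟨k, hk, by rw [G.dist_comm]; linarith⟩
      · exact ⟨v, by have := S.cover v; tauto, by simp [G.dist_self]⟩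
    refine le_trans ?_ (hM' k hk)
    have h1 := G.dist_triangle x₀ k v
    have h2 := G.dist_triangle v x₀ k
    rw [G.dist_comm v x₀] at h2
    rw [G.dist_comm k v] at h1
    have h4 := abs_le.1 (le_refl |f k|)
    rw [h, abs_le]
    constructor <;> linarith

namespace HarmonicProfile

variable {w : V → V → ℝ} {m : V → ℝ} {d : V → V → ℝ} {X Y K : Set V} {g : V → ℝ}

/-- `|g|` is the distance to a base point up to a bounded error. -/
theorem exists_abs_asymptotics (H : HarmonicProfile w m d X Y K g) (x₀ : V) :
    ∃ M, 0 ≤ M ∧ ∀ v, |(|g v| - d x₀ v)| ≤ M := by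
  obtain ⟨M, hM, h1, h2⟩ := H.graph.exists_asymptotics H.part.separates H.ext x₀
  refine ⟨M, hM, fun v => ?_⟩
  have hd := H.graph.dist_nonneg x₀ v
  by_cases hv : v ∈ Y
  · have h3 := h2 v fun h => H.part.separates.disjXY v h hv
    have h4 := abs_abs_sub_abs_le_abs_sub (g v) (d x₀ v)
    rw [abs_of_nonneg hd] at h4
    exact h4.trans h3
  · have h3 := h1 v hv
    have h4 := abs_abs_sub_abs_le_abs_sub (g v) (-d x₀ v)
    rw [abs_neg, abs_of_nonneg hd, sub_neg_eq_add] at h4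
    exact h4.trans h3

theorem finite_level (H : HarmonicProfile w m d X Y K g) (T : ℝ) : {v | |g v| ≤ T}.Finite := by
  rcases isEmpty_or_nonempty V with _ | ⟨⟨x₀⟩⟩
  · exact Set.toFinite _
  obtain ⟨M, hM, h⟩ := H.exists_abs_asymptotics x₀
  refine (H.graph.finite_ball x₀ (T + M)).subset fun v hv => ?_
  have h1 := (abs_le.1 (h v)).1
  have h2 : |g v| ≤ T := hv
  exact Set.mem_ofPred_eq ▸ (by linarith : d x₀ v ≤ T + M)

/-- The finite set `{|g| ≤ T}`. -/
noncomputable def level (H : HarmonicProfile w m d X Y K g) (T : ℝ) : Finset V :=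
  (H.finite_level T).toFinset

theorem mem_level (H : HarmonicProfile w m d X Y K g) {T : ℝ} {v : V} :
    v ∈ H.level T ↔ |g v| ≤ T := by
  simp [level]

theorem exists_up_nbr (H : HarmonicProfile w m d X Y K g) {x : V} (hx : x ∈ X) :
    ∃ z, 0 < w x z ∧ g z = g x + 1 := by
  obtain ⟨k, hk, h⟩ := H.ext.up x hx
  have hne : x ≠ k := by
    rintro rfl
    exact H.part.separates.disjXK x hx hk
  obtain ⟨z, hz, hzk⟩ := H.graph.exists_step x k hne
  have h1 := H.ext.lip x z
  have h2 := H.ext.lip z k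
  rw [H.graph.dist_adj x z hz] at h1
  exact ⟨z, hz, by linarith⟩

theorem exists_lower_nbr (H : HarmonicProfile w m d X Y K g) {x : V} (hx : x ∈ X) :
    ∃ z, 0 < w x z ∧ g z < g x := by
  by_contra! hcon
  obtain ⟨z, hz, hgz⟩ := H.exists_up_nbr hx
  have h := H.harm x
  rw [H.graph.netFlow_nbrs] at h
  have h1 : 0 < ∑ y ∈ (H.graph.locFin x).toFinset, w x y * (g y - g x) := by
    refine Finset.sum_pos' (fun y hy => ?_) ⟨z, by simpa using hz, ?_⟩
    · have : 0 < w x y := by simpa using hy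
      exact mul_nonneg this.le (by linarith [hcon y this])
    · exact mul_pos hz (by linarith)
  linarith

theorem exists_down_flow_bound_left (H : HarmonicProfile w m d X Y K g) :
    ∃ C, 0 ≤ C ∧ ∀ v ∈ X, ∑ y ∈ (H.graph.locFin v).toFinset, w v y * max 0 (g v - g y) ≤ C := by
  classical
  obtain ⟨C, hC, h⟩ := H.graph.exists_superlevel_flow_bound H.part.separates
  refine ⟨C, hC, fun v hv => ?_⟩
  have hfin := H.graph.finite_superlevel H.part.separates H.ext (g v)
  obtain ⟨U, hAU, hU⟩ := H.graph.exists_closed_nbhd hfin.toFinset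
  have h1 := h g H.ext.lip (g v) hfin.toFinset U (by simp) hAU hU
  rw [Finset.sum_congr rfl fun x _ => H.harm x, Finset.sum_const_zero, zero_add] at h1
  have hvA : v ∈ hfin.toFinset := by simpa using hv
  have hnn : ∀ x y, 0 ≤ w x y * max 0 (g x - g y) := fun x y =>
    mul_nonneg (H.graph.nonneg _ _) (le_max_left _ _)
  refine le_trans ?_ ((Finset.single_le_sum (f := fun x => ∑ y ∈ U \ hfin.toFinset,
    w x y * max 0 (g x - g y)) (fun x _ => Finset.sum_nonneg fun y _ => hnn x y) hvA).trans h1)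
  rw [← Finset.sum_filter_add_sum_filter_not _ (· ∈ hfin.toFinset)]
  rw [Finset.sum_eq_zero fun y hy => ?_, zero_add]
  · refine Finset.sum_le_sum_of_subset_of_nonneg (fun y hy => ?_) fun y _ _ => hnn v y
    rw [Finset.mem_filter] at hy
    exact Finset.mem_sdiff.2 ⟨hU v hvA y (by simpa using hy.1), hy.2⟩
  · have := ((Set.Finite.mem_toFinset _).1 (Finset.mem_filter.1 hy).2).2
    rw [max_eq_left (by linarith), mul_zero]

theorem sum_max_eq (H : HarmonicProfile w m d X Y K g) (v : V) :
    ∑ y ∈ (H.graph.locFin v).toFinset, w v y * max 0 (g y - g v) =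
      ∑ y ∈ (H.graph.locFin v).toFinset, w v y * max 0 (g v - g y) := by
  have h := H.harm v
  rw [H.graph.netFlow_nbrs] at h
  refine sub_eq_zero.1 (Eq.trans ?_ h)
  rw [← Finset.sum_sub_distrib]
  refine Finset.sum_congr rfl fun y _ => ?_
  rcases le_total (g v) (g y) with h | h
  · rw [max_eq_right (by linarith), max_eq_left (by linarith)]; ring
  · rw [max_eq_left (by linarith), max_eq_right (by linarith)]; ring

/-- The total absolute flow of `g` through a vertex is uniformly bounded. -/
theorem exists_abs_flow_bound (H : HarmonicProfile w m d X Y K g) :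
    ∃ C, 0 ≤ C ∧ ∀ v, ∑ y ∈ (H.graph.locFin v).toFinset, w v y * |g y - g v| ≤ C := by
  obtain ⟨C₁, hC₁, h₁⟩ := H.exists_down_flow_bound_left
  obtain ⟨C₂, hC₂, h₂⟩ := H.neg.exists_down_flow_bound_left
  have hsplit : ∀ v, ∑ y ∈ (H.graph.locFin v).toFinset, w v y * |g y - g v| =
      2 * ∑ y ∈ (H.graph.locFin v).toFinset, w v y * max 0 (g v - g y) := by
    intro v
    rw [two_mul]
    nth_rw 1 [← H.sum_max_eq v]
    rw [← Finset.sum_add_distrib]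
    refine Finset.sum_congr rfl fun y _ => ?_
    rcases le_total (g v) (g y) with h | h
    · rw [max_eq_right (by linarith), max_eq_left (by linarith), abs_of_nonneg (by linarith)]; ring
    · rw [max_eq_left (by linarith), max_eq_right (by linarith), abs_of_nonpos (by linarith)]; ring
  obtain ⟨C₃, hC₃⟩ := (H.part.separates.fin.image fun v =>
    ∑ y ∈ (H.graph.locFin v).toFinset, w v y * |g y - g v|).bddAbove
  refine ⟨max (2 * C₁ + 2 * C₂) C₃, le_max_of_le_left (by positivity), fun v => ?_⟩
  rcases H.part.separates.cover v with h | h | h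
  · refine le_max_of_le_left ?_
    rw [hsplit]
    linarith [h₁ v h]
  · refine le_max_of_le_left ?_
    rw [hsplit, ← H.sum_max_eq]
    have := h₂ v h
    simp only [neg_sub_neg] at this
    linarith
  · exact le_max_of_le_right (hC₃ ⟨v, h, rfl⟩)

theorem exists_slab_card_le_left (H : HarmonicProfile w m d X Y K g) :
    ∃ N : ℕ, ∀ t, ∀ F : Finset V, (∀ v ∈ F, v ∈ X ∧ t ≤ g v ∧ g v ≤ t + 1) → F.card ≤ N := by
  classical
  obtain ⟨C, hC, h⟩ := H.graph.exists_superlevel_flow_bound H.part.separates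
  obtain ⟨ε, hε, hw⟩ := H.weight_low
  obtain ⟨W, hKW, hW⟩ := H.graph.exists_closed_nbhd H.part.separates.fin.toFinset
  suffices hmain : ∃ N : ℕ, ∀ t, ∀ F : Finset V, (∀ v ∈ F, v ∈ X ∧ t ≤ g v ∧ g v < t + 1) →
      F.card ≤ N by
    obtain ⟨N, hN⟩ := hmain
    refine ⟨N + N, fun t F hF => ?_⟩
    rw [← Finset.card_filter_add_card_filter_not (s := F) (g · < t + 1)]
    refine add_le_add (hN t _ fun v hv => ?_) (hN (t + 1) _ fun v hv => ?_)
    · rw [Finset.mem_filter] at hv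
      exact ⟨(hF v hv.1).1, (hF v hv.1).2.1, hv.2⟩
    · rw [Finset.mem_filter] at hv
      have := hF v hv.1
      exact ⟨this.1, by linarith [hv.2], by linarith⟩
  refine ⟨⌊C / ε⌋₊ + W.card, fun t F hF => ?_⟩
  have hfin := H.graph.finite_superlevel H.part.separates H.ext (t + 1)
  obtain ⟨U, hAU, hU⟩ := H.graph.exists_closed_nbhd hfin.toFinset
  have h1 := h g H.ext.lip (t + 1) hfin.toFinset U (by simp) hAU hU
  rw [Finset.sum_congr rfl fun x _ => H.harm x, Finset.sum_const_zero, zero_add,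
    Finset.sum_comm] at h1
  have hnn : ∀ x y, 0 ≤ w x y * max 0 (g x - g y) := fun x y =>
    mul_nonneg (H.graph.nonneg _ _) (le_max_left _ _)
  have hout : ∀ v ∈ F \ W, ∃ z ∈ hfin.toFinset, 0 < w z v ∧ g z = g v + 1 := by
    intro v hv
    rw [Finset.mem_sdiff] at hv
    obtain ⟨hvX, hvt, -⟩ := hF v hv.1
    obtain ⟨z, hz, hgz⟩ := H.exists_up_nbr hvX
    refine ⟨z, ?_, H.graph.adj_symm hz, hgz⟩
    rcases H.part.separates.cover z with h | h | h
    · simpa using ⟨h, by linarith⟩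
    · exact absurd hz (by simp [H.part.separates.nonadj v hvX z h])
    · exact absurd (hW z (by simpa using h) v (H.graph.adj_symm hz)) hv.2
  have h2 : ((F \ W).card : ℝ) * ε ≤ C := by
    rw [← nsmul_eq_mul]
    refine (Finset.card_nsmul_le_sum _ (fun v => ∑ x ∈ hfin.toFinset,
      w x v * max 0 (g x - g v)) _ fun v hv => ?_).trans
      ((Finset.sum_le_sum_of_subset_of_nonneg (fun v hv => ?_)
        fun y _ _ => Finset.sum_nonneg fun x _ => hnn x y).trans h1)
    · obtain ⟨z, hz, hzv, hgz⟩ := hout v hv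
      refine le_trans ?_ (Finset.single_le_sum (f := fun x => w x v * max 0 (g x - g v))
        (fun x _ => hnn x v) hz)
      have : max 0 (g z - g v) = 1 := by rw [hgz, max_eq_right] <;> linarith
      rw [this, mul_one]
      exact hw z v hzv
    · obtain ⟨z, hz, hzv, hgz⟩ := hout v hv
      refine Finset.mem_sdiff.2 ⟨hU z hz v hzv, fun hvA => ?_⟩
      have h3 := ((Set.Finite.mem_toFinset _).1 hvA).2
      have h4 := hF v (Finset.mem_sdiff.1 hv).1
      linarith
  have h3 : (F \ W).card ≤ ⌊C / ε⌋₊ := Nat.le_floor ((le_div_iff₀ hε).2 h2)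
  have h4 : F.card ≤ (F \ W).card + W.card := Finset.card_le_card_sdiff_add_card
  omega

/-- Unit slabs `{t ≤ g ≤ t + 1}` have uniformly bounded cardinality. -/
theorem exists_slab_card_le (H : HarmonicProfile w m d X Y K g) :
    ∃ N : ℕ, ∀ t, ∀ F : Finset V, (∀ v ∈ F, t ≤ g v ∧ g v ≤ t + 1) → F.card ≤ N := by
  classical
  obtain ⟨N₁, h₁⟩ := H.exists_slab_card_le_left
  obtain ⟨N₂, h₂⟩ := H.neg.exists_slab_card_le_left
  refine ⟨N₁ + N₂ + H.part.separates.fin.toFinset.card, fun t F hF => ?_⟩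
  have h3 := h₁ t (F.filter (· ∈ X)) fun v hv => by
    rw [Finset.mem_filter] at hv
    exact ⟨hv.2, hF v hv.1⟩
  have h4 := h₂ (-t - 1) (F.filter (· ∈ Y)) fun v hv => by
    rw [Finset.mem_filter] at hv
    have := hF v hv.1
    exact ⟨hv.2, by linarith, by linarith⟩
  have h5 : F ⊆ F.filter (· ∈ X) ∪ F.filter (· ∈ Y) ∪ H.part.separates.fin.toFinset := by
    intro v hv
    have := H.part.separates.cover v
    simp only [Finset.mem_union, Finset.mem_filter, Set.Finite.mem_toFinset]
    tauto
  have h6 := Finset.card_le_card h5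
  have h7 := Finset.card_union_le (F.filter (· ∈ X) ∪ F.filter (· ∈ Y))
    H.part.separates.fin.toFinset
  have h8 := Finset.card_union_le (F.filter (· ∈ X)) (F.filter (· ∈ Y))
  omega

end HarmonicProfile

open Classical in
/-- The flow of `θ` out of `A` through the edges with both ends in `U`. -/
noncomputable def bdFlow (w : V → V → ℝ) (U : Finset V) (A : Set V) (θ : V → ℝ) : ℝ :=
  ∑ x ∈ U, ∑ y ∈ U, if x ∈ A ∧ y ∉ A then w x y * (θ y - θ x) else 0

theorem bdFlow_compl {w : V → V → ℝ} (hw : ∀ x y, w x y = w y x) (U : Finset V) (A : Set V)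
    (θ : V → ℝ) : bdFlow w U Aᶜ θ = -bdFlow w U A θ := by
  unfold bdFlow
  rw [Finset.sum_comm, ← Finset.sum_neg_distrib]
  refine Finset.sum_congr rfl fun x _ => ?_
  rw [← Finset.sum_neg_distrib]
  refine Finset.sum_congr rfl fun y _ => ?_
  by_cases hx : x ∈ A <;> by_cases hy : y ∈ A <;> simp [hx, hy]
  rw [hw y x]
  ring

theorem bdFlow_sub (w : V → V → ℝ) (U : Finset V) (A : Set V) (θ η : V → ℝ) :
    bdFlow w U A (fun v => θ v - η v) = bdFlow w U A θ - bdFlow w U A η := by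
  unfold bdFlow
  simp only [← Finset.sum_sub_distrib]
  refine Finset.sum_congr rfl fun x _ => Finset.sum_congr rfl fun y _ => ?_
  split_ifs <;> ring

theorem bdFlow_const_mul (w : V → V → ℝ) (U : Finset V) (A : Set V) (c : ℝ) (θ : V → ℝ) :
    bdFlow w U A (fun v => c * θ v) = c * bdFlow w U A θ := by
  unfold bdFlow
  simp only [Finset.mul_sum]
  refine Finset.sum_congr rfl fun x _ => Finset.sum_congr rfl fun y _ => ?_
  split_ifs <;> ring

/-- `η` equal to `1` for `|s| ≤ a`, to `0` for `|s| ≥ a + ℓ`, and linear in between. -/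
noncomputable def ramp (a ℓ s : ℝ) : ℝ := max 0 (min 1 ((a + ℓ - |s|) / ℓ))

theorem ramp_nonneg (a ℓ s : ℝ) : 0 ≤ ramp a ℓ s := le_max_left _ _

theorem ramp_of_le {a ℓ s : ℝ} (hℓ : 0 < ℓ) (h : |s| ≤ a) : ramp a ℓ s = 1 := by
  have : 1 ≤ (a + ℓ - |s|) / ℓ := by rw [le_div_iff₀ hℓ]; linarith
  rw [ramp, min_eq_left this, max_eq_right zero_le_one]

theorem ramp_of_ge {a ℓ s : ℝ} (hℓ : 0 < ℓ) (h : a + ℓ ≤ |s|) : ramp a ℓ s = 0 := by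
  have : (a + ℓ - |s|) / ℓ ≤ 0 := div_nonpos_of_nonpos_of_nonneg (by linarith) hℓ.le
  rw [ramp, min_eq_right (by linarith), max_eq_left this]

theorem ramp_of_mem {a ℓ s : ℝ} (hℓ : 0 < ℓ) (h : a ≤ |s|) (h' : |s| ≤ a + ℓ) :
    ramp a ℓ s = (a + ℓ - |s|) / ℓ := by
  have h1 : 0 ≤ (a + ℓ - |s|) / ℓ := div_nonneg (by linarith) hℓ.le
  have h2 : (a + ℓ - |s|) / ℓ ≤ 1 := by rw [div_le_iff₀ hℓ]; linarith
  rw [ramp, min_eq_right h2, max_eq_right h1]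

theorem abs_ramp_sub_le {a ℓ : ℝ} (hℓ : 0 < ℓ) (s t : ℝ) :
    |ramp a ℓ t - ramp a ℓ s| ≤ |t - s| / ℓ := by
  have h1 := abs_max_sub_max_le_abs (min 1 ((a + ℓ - |t|) / ℓ)) (min 1 ((a + ℓ - |s|) / ℓ)) 0
  rw [max_comm _ (0 : ℝ), max_comm _ (0 : ℝ)] at h1
  have h2 := abs_min_sub_min_le_max 1 ((a + ℓ - |t|) / ℓ) 1 ((a + ℓ - |s|) / ℓ)
  rw [sub_self, abs_zero, max_eq_right (abs_nonneg _)] at h2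
  have h3 : (a + ℓ - |t|) / ℓ - (a + ℓ - |s|) / ℓ = -((|t| - |s|) / ℓ) := by ring
  rw [h3, abs_neg, abs_div, abs_of_pos hℓ] at h2
  have h4 : |(|t| - |s|)| / ℓ ≤ |t - s| / ℓ :=
    div_le_div_of_nonneg_right (abs_abs_sub_abs_le_abs_sub t s) hℓ.le
  exact h1.trans (h2.trans h4)

namespace HarmonicProfile

variable {w : V → V → ℝ} {m : V → ℝ} {d : V → V → ℝ} {X Y K : Set V} {g : V → ℝ}

theorem ramp_flow_eq_zero (H : HarmonicProfile w m d X Y K g) {a ℓ : ℝ} (ha : 0 ≤ a)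
    (hℓ : 0 < ℓ) {x : V} (h : |g x| ≤ a - 1 ∨ a + ℓ + 1 ≤ |g x| ∨
      (a + 1 ≤ |g x| ∧ |g x| ≤ a + ℓ - 1)) :
    netFlow w (fun v => ramp a ℓ (g v)) x = 0 := by
  have hnbr : ∀ y, 0 < w x y → |(|g y| - |g x|)| ≤ 1 := fun y hy =>
    (abs_abs_sub_abs_le_abs_sub _ _).trans (H.abs_sub_le_one hy)
  rw [H.graph.netFlow_nbrs]
  rcases h with h | h | ⟨h, h'⟩
  · refine Finset.sum_eq_zero fun y hy => ?_
    have := abs_le.1 (hnbr y (by simpa using hy))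
    rw [ramp_of_le hℓ (by linarith), ramp_of_le hℓ (by linarith), sub_self, mul_zero]
  · refine Finset.sum_eq_zero fun y hy => ?_
    have := abs_le.1 (hnbr y (by simpa using hy))
    rw [ramp_of_ge hℓ (by linarith), ramp_of_ge hℓ (by linarith), sub_self, mul_zero]
  · have hsign : ∃ s : ℝ, ∀ y, (y = x ∨ 0 < w x y) → |g y| = s * g y := by
      rcases le_total 0 (g x) with h0 | h0
      · refine ⟨1, fun y hy => ?_⟩
        rw [one_mul, abs_of_nonneg]
        rcases hy with rfl | hy
        · exact h0
        · have := abs_le.1 (H.abs_sub_le_one hy)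
          rw [abs_of_nonneg h0] at h
          linarith
      · refine ⟨-1, fun y hy => ?_⟩
        rw [neg_one_mul, abs_of_nonpos]
        rcases hy with rfl | hy
        · exact h0
        · have := abs_le.1 (H.abs_sub_le_one hy)
          rw [abs_of_nonpos h0] at h
          linarith
    obtain ⟨s, hs⟩ := hsign
    have h1 := H.harm x
    rw [H.graph.netFlow_nbrs] at h1
    calc ∑ y ∈ (H.graph.locFin x).toFinset, w x y * (ramp a ℓ (g y) - ramp a ℓ (g x))
        = ∑ y ∈ (H.graph.locFin x).toFinset, -(s / ℓ) * (w x y * (g y - g x)) := by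
          refine Finset.sum_congr rfl fun y hy => ?_
          have hxy : 0 < w x y := by simpa using hy
          have := abs_le.1 (hnbr y hxy)
          rw [ramp_of_mem hℓ (s := g y) (by linarith) (by linarith),
            ramp_of_mem hℓ (s := g x) (by linarith) (by linarith), hs y (Or.inr hxy),
            hs x (Or.inl rfl)]
          ring
      _ = 0 := by rw [← Finset.mul_sum, h1, mul_zero]

/-- The total flow of a cutoff function is of order `1 / ℓ`. -/
theorem exists_ramp_flow_bound (H : HarmonicProfile w m d X Y K g) :
    ∃ C, 0 ≤ C ∧ ∀ a ℓ : ℝ, 0 ≤ a → 0 < ℓ → ∀ F : Finset V,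
      ∑ x ∈ F, |netFlow w (fun v => ramp a ℓ (g v)) x| ≤ C / ℓ := by
  classical
  obtain ⟨C, hC, hflow⟩ := H.exists_abs_flow_bound
  obtain ⟨N, hN⟩ := H.exists_slab_card_le
  refine ⟨(8 * N) * C, by positivity, fun a ℓ ha hℓ F => ?_⟩
  have hpt : ∀ x, |netFlow w (fun v => ramp a ℓ (g v)) x| ≤ C / ℓ := by
    intro x
    rw [H.graph.netFlow_nbrs]
    refine (Finset.abs_sum_le_sum_abs _ _).trans
      (le_trans ?_ (div_le_div_of_nonneg_right (hflow x) hℓ.le))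
    rw [Finset.sum_div]
    refine Finset.sum_le_sum fun y _ => ?_
    rw [abs_mul, abs_of_nonneg (H.graph.nonneg x y), mul_div_assoc]
    exact mul_le_mul_of_nonneg_left (abs_ramp_sub_le hℓ _ _) (H.graph.nonneg x y)
  have hN' : ∀ s, (F.filter fun v => s ≤ g v ∧ g v ≤ s + 1).card ≤ N := fun s =>
    hN s _ fun v hv => (Finset.mem_filter.1 hv).2
  set T : Finset ℝ := {a - 1, a, a + ℓ - 1, a + ℓ, -a - 1, -a, -a - ℓ - 1, -a - ℓ} with hT
  set F' := T.biUnion fun s => F.filter fun v => s ≤ g v ∧ g v ≤ s + 1 with hF'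
  have hcard : F'.card ≤ 8 * N := by
    refine Finset.card_biUnion_le.trans ((Finset.sum_le_sum fun s _ => hN' s).trans ?_)
    rw [Finset.sum_const, smul_eq_mul]
    exact Nat.mul_le_mul_right _ ((Finset.card_insert_le _ _).trans (Nat.succ_le_succ
      ((Finset.card_insert_le _ _).trans (Nat.succ_le_succ Finset.card_le_six))))
  have hzero : ∀ x ∈ F, x ∉ F' → |netFlow w (fun v => ramp a ℓ (g v)) x| = 0 := by
    intro x hx hx'
    rw [abs_eq_zero]
    refine H.ramp_flow_eq_zero ha hℓ ?_
    by_contra hcon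
    push Not at hcon
    obtain ⟨h1, h2, h3⟩ := hcon
    have hmem : ∀ s ∈ T, s ≤ g x → s + 1 < g x := by
      intro s hs hsx
      by_contra! hle
      exact hx' (Finset.mem_biUnion.2 ⟨s, hs, Finset.mem_filter.2 ⟨hx, hsx, hle⟩⟩)
    simp only [hT, Finset.mem_insert, Finset.mem_singleton, forall_eq_or_imp, forall_eq] at hmem
    obtain ⟨m1, m2, m3, m4, m5, m6, m7, m8⟩ := hmem
    rcases le_total 0 (g x) with h0 | h0
    · rw [abs_of_nonneg h0] at h1 h2 h3
      have k2 := m2 (by linarith [m1 h1.le])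
      have k3 := m3 (h3 k2.le).le
      have k4 := m4 (by linarith)
      linarith
    · rw [abs_of_nonpos h0] at h1 h2 h3
      have k7 : -a - ℓ < g x := by linarith [m7 (by linarith)]
      have k8 := m8 k7.le
      have k5 : -a - 1 < g x := by
        by_contra! hle
        linarith [h3 (by linarith)]
      have k6 := m5 k5.le
      have := m6 (by linarith)
      linarith
  calc ∑ x ∈ F, |netFlow w (fun v => ramp a ℓ (g v)) x|
      = ∑ x ∈ F', |netFlow w (fun v => ramp a ℓ (g v)) x| := by
        refine (Finset.sum_subset (fun x hx => ?_) hzero).symm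
        obtain ⟨s, -, hs⟩ := Finset.mem_biUnion.1 hx
        exact (Finset.mem_filter.1 hs).1
    _ ≤ F'.card • (C / ℓ) := Finset.sum_le_card_nsmul _ _ _ fun x _ => hpt x
    _ ≤ (8 * N) * C / ℓ := by
        rw [nsmul_eq_mul, mul_div_assoc]
        refine mul_le_mul_of_nonneg_right ?_ (div_nonneg hC hℓ.le)
        exact_mod_cast hcard

/-- Green's formula with a cutoff: for `θ` subharmonic on `A`, the mass of the Laplacian of `θ`
is controlled by the flow through the boundary of `A` and the size of `θ` far out. -/
theorem exists_cutoff_green (H : HarmonicProfile w m d X Y K g) :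
    ∃ C, 0 ≤ C ∧ ∀ a ℓ : ℝ, 0 ≤ a → 0 < ℓ → ∀ (A : Set V) (θ : V → ℝ) (M : ℝ), 0 ≤ M →
      (∀ x ∈ A, ∀ y, y ∉ A → 0 < w x y → |g x| ≤ a - 1) →
      (∀ x ∈ A, 0 ≤ netFlow w θ x) →
      (∀ x ∈ A, a - 1 ≤ |g x| → |g x| ≤ a + ℓ + 1 → |θ x| ≤ M) →
      ∀ F : Finset V, (∀ x ∈ F, x ∈ A ∧ |g x| ≤ a) →
      ∑ x ∈ F, netFlow w θ x ≤ bdFlow w (H.level a) A θ + C * M / ℓ := by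
  classical
  obtain ⟨C, hC, hramp⟩ := H.exists_ramp_flow_bound
  refine ⟨C, hC, fun a ℓ ha hℓ A θ M hM hbd hsub hθ F hF => ?_⟩
  set η : V → ℝ := fun v => ramp a ℓ (g v) with hη
  set U := H.level a with hU
  set A' := (H.level (a + ℓ + 1)).filter (· ∈ A) with hA'
  have memA' : ∀ v, v ∈ A' ↔ |g v| ≤ a + ℓ + 1 ∧ v ∈ A := fun v => by
    rw [hA', Finset.mem_filter, H.mem_level]
  obtain ⟨W, hW1, hW2⟩ := H.graph.exists_closed_nbhd (A' ∪ U)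
  have hA'W : A' ⊆ W := Finset.subset_union_left.trans hW1
  have hUW : U ⊆ W := Finset.subset_union_right.trans hW1
  have hnbr : ∀ x y, 0 < w x y → |g y| ≤ |g x| + 1 := fun x y hy => by
    linarith [(abs_le.1 ((abs_abs_sub_abs_le_abs_sub (g y) (g x)).trans
      (H.abs_sub_le_one hy))).2]
  have hnbr' : ∀ x y, 0 < w x y → |g x| ≤ |g y| + 1 := fun x y hy =>
    hnbr y x (H.graph.adj_symm hy)
  have hgreen := H.graph.green hA'W
    (fun x hx => hW2 x (Finset.mem_union_left _ hx)) η θ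
  set Φ : V → V → ℝ := fun x y => if (x ∈ A ∧ y ∉ A) ∧ x ∈ U ∧ y ∈ U then
    w x y * (θ y - θ x) else 0 with hΦ
  have hterm : ∀ x ∈ A', ∀ y ∈ W \ A', w x y * (η x * θ y - θ x * η y) = Φ x y := by
    intro x hx y hy
    have hxA := (memA' x).1 hx
    have hyA' : y ∉ A' := (Finset.mem_sdiff.1 hy).2
    rcases (H.graph.nonneg x y).eq_or_lt with h0 | h0
    · simp [hΦ, ← h0]
    by_cases hyA : y ∈ A
    · have h1 : a + ℓ + 1 < |g y| := by
        by_contra! hle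
        exact hyA' ((memA' y).2 ⟨hle, hyA⟩)
      have h2 := hnbr x y h0
      simp only [hη, hΦ]
      rw [ramp_of_ge hℓ (s := g x) (by linarith), ramp_of_ge hℓ (s := g y) (by linarith),
        if_neg (by tauto)]
      ring
    · have h1 := hbd x hxA.2 y hyA h0
      have h2 := hnbr x y h0
      have hxU : x ∈ U := H.mem_level.2 (by linarith)
      have hyU : y ∈ U := H.mem_level.2 (by linarith)
      simp only [hη, hΦ]
      rw [ramp_of_le hℓ (s := g x) (by linarith), ramp_of_le hℓ (s := g y) (by linarith),
        if_pos ⟨⟨hxA.2, hyA⟩, hxU, hyU⟩]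
      ring
  have hUA' : ∀ x, x ∈ A → x ∈ U → x ∈ A' := fun x hx hxU =>
    (memA' x).2 ⟨by linarith [H.mem_level.1 hxU], hx⟩
  have hflux : ∑ x ∈ A', ∑ y ∈ W \ A', w x y * (η x * θ y - θ x * η y) = bdFlow w U A θ := by
    rw [Finset.sum_congr rfl fun x hx => Finset.sum_congr rfl fun y hy => hterm x hx y hy]
    have h1 : ∀ x, ∑ y ∈ W \ A', Φ x y = ∑ y ∈ W, Φ x y := fun x =>
      Finset.sum_subset Finset.sdiff_subset fun y hy hy' => by
        have hyA' : y ∈ A' := by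
          by_contra hc
          exact hy' (Finset.mem_sdiff.2 ⟨hy, hc⟩)
        exact if_neg fun h => h.1.2 ((memA' y).1 hyA').2
    have h2 : ∀ x, ∑ y ∈ U, Φ x y = ∑ y ∈ W, Φ x y := fun x =>
      Finset.sum_subset hUW fun y _ hy' => if_neg fun h => hy' h.2.2
    have h3 : ∑ x ∈ A', ∑ y ∈ W, Φ x y = ∑ x ∈ W, ∑ y ∈ W, Φ x y :=
      Finset.sum_subset hA'W fun x _ hx' => Finset.sum_eq_zero fun y _ =>
        if_neg fun h => hx' (hUA' x h.1.1 h.2.1)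
    have h4 : ∑ x ∈ U, ∑ y ∈ W, Φ x y = ∑ x ∈ W, ∑ y ∈ W, Φ x y :=
      Finset.sum_subset hUW fun x _ hx' => Finset.sum_eq_zero fun y _ =>
        if_neg fun h => hx' h.2.1
    rw [Finset.sum_congr rfl fun x _ => h1 x, h3, ← h4, ← Finset.sum_congr rfl fun x _ => h2 x]
    refine Finset.sum_congr rfl fun x hx => Finset.sum_congr rfl fun y hy => ?_
    simp only [hΦ, hx, hy, and_true]
  have hmass : ∑ x ∈ F, netFlow w θ x ≤ ∑ x ∈ A', η x * netFlow w θ x := by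
    have h1 : ∑ x ∈ F, netFlow w θ x = ∑ x ∈ F, η x * netFlow w θ x :=
      Finset.sum_congr rfl fun x hx => by
        simp only [hη]
        rw [ramp_of_le hℓ (hF x hx).2, one_mul]
    rw [h1]
    refine Finset.sum_le_sum_of_subset_of_nonneg (fun x hx => ?_) fun x hx _ => ?_
    · exact (memA' x).2 ⟨by linarith [(hF x hx).2], (hF x hx).1⟩
    · exact mul_nonneg (ramp_nonneg _ _ _) (hsub x ((memA' x).1 hx).2)
  have herr : ∑ x ∈ A', θ x * netFlow w η x ≤ C * M / ℓ := by
    have h1 : ∀ x ∈ A', θ x * netFlow w η x ≤ M * |netFlow w η x| := by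
      intro x hx
      have hxA := (memA' x).1 hx
      by_cases hlow : |g x| ≤ a - 1
      · rw [H.ramp_flow_eq_zero ha hℓ (Or.inl hlow)]
        simp
      · refine (le_abs_self _).trans ?_
        rw [abs_mul]
        exact mul_le_mul_of_nonneg_right (hθ x hxA.2 (not_le.1 hlow).le hxA.1) (abs_nonneg _)
    refine (Finset.sum_le_sum h1).trans ?_
    rw [← Finset.mul_sum]
    refine (mul_le_mul_of_nonneg_left (hramp a ℓ ha hℓ A') hM).trans_eq ?_
    ring
  rw [Finset.sum_sub_distrib, hflux] at hgreen
  linarith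

/-- The bounded version of the cutoff formula. -/
theorem sum_netFlow_le_bdFlow (H : HarmonicProfile w m d X Y K g) {a : ℝ} (ha : 0 ≤ a)
    {A : Set V} {θ : V → ℝ} {M : ℝ}
    (hbd : ∀ x ∈ A, ∀ y, y ∉ A → 0 < w x y → |g x| ≤ a - 1)
    (hsub : ∀ x ∈ A, 0 ≤ netFlow w θ x) (hθ : ∀ x ∈ A, |θ x| ≤ M)
    {F : Finset V} (hF : ∀ x ∈ F, x ∈ A ∧ |g x| ≤ a) :
    ∑ x ∈ F, netFlow w θ x ≤ bdFlow w (H.level a) A θ := by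
  obtain ⟨C, hC, h⟩ := H.exists_cutoff_green
  have hlim : Tendsto (fun ℓ : ℝ => bdFlow w (H.level a) A θ + C * max 0 M / ℓ) atTop
      (nhds (bdFlow w (H.level a) A θ + 0)) :=
    tendsto_const_nhds.add (tendsto_const_nhds.div_atTop tendsto_id)
  rw [add_zero] at hlim
  refine ge_of_tendsto hlim ((eventually_gt_atTop 0).mono fun ℓ hℓ => ?_)
  exact h a ℓ ha hℓ A θ _ (le_max_left _ _) hbd hsub
    (fun x hx _ _ => (hθ x hx).trans (le_max_right _ _)) F hF

/-- A bounded function harmonic on `A` has no flow through the boundary of `A`. -/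
theorem bdFlow_eq_zero (H : HarmonicProfile w m d X Y K g) {a : ℝ} (ha : 0 ≤ a)
    {A : Set V} {θ : V → ℝ} {M : ℝ}
    (hbd : ∀ x ∈ A, ∀ y, y ∉ A → 0 < w x y → |g x| ≤ a - 1)
    (hharm : ∀ x ∈ A, netFlow w θ x = 0) (hθ : ∀ x ∈ A, |θ x| ≤ M) :
    bdFlow w (H.level a) A θ = 0 := by
  have h1 := H.sum_netFlow_le_bdFlow ha hbd (fun x hx => (hharm x hx).ge) hθ (F := ∅) (by simp)
  have h2 := H.sum_netFlow_le_bdFlow ha hbd (θ := fun v => -θ v)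
    (fun x hx => by rw [netFlow_neg, hharm x hx, neg_zero])
    (fun x hx => by rw [abs_neg]; exact hθ x hx) (F := ∅) (by simp)
  have h3 : bdFlow w (H.level a) A (fun v => -θ v) = -bdFlow w (H.level a) A θ := by
    have := bdFlow_const_mul w (H.level a) A (-1) θ
    simpa using this
  rw [h3] at h2
  simp only [Finset.sum_empty] at h1 h2
  linarith

end HarmonicProfile

theorem infVolume_union {m : V → ℝ} {A B : Set V} (h : InfVolume m (A ∪ B)) :
    InfVolume m A ∨ InfVolume m B := by
  classical
  by_contra hcon
  simp only [InfVolume] at hcon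
  push Not at hcon
  obtain ⟨⟨a, ha⟩, b, hb⟩ := hcon
  obtain ⟨F, hF, hsum⟩ := h (a + b)
  have h1 := ha (F.filter (· ∈ A)) fun x hx => (Finset.mem_filter.1 (Finset.mem_coe.1 hx)).2
  have h2 := hb (F.filter (· ∉ A)) fun x hx => by
    have := Finset.mem_filter.1 (Finset.mem_coe.1 hx)
    exact (hF (Finset.mem_coe.2 this.1)).resolve_left this.2
  have h3 := Finset.sum_filter_add_sum_filter_not F (· ∈ A) m
  linarith

theorem InfVolume.mono {m : V → ℝ} {A B : Set V} (h : InfVolume m A) (hAB : A ⊆ B) :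
    InfVolume m B := fun c => by
  obtain ⟨F, hF, hs⟩ := h c
  exact ⟨F, hF.trans hAB, hs⟩

theorem exists_ball_superset (d : V → V → ℝ) {F : Set V} (hF : F.Finite) (x₀ : V) :
    ∃ R, 0 ≤ R ∧ F ⊆ {v | d x₀ v ≤ R} := by
  obtain ⟨R, hR⟩ := (hF.image fun v => d x₀ v).bddAbove
  exact ⟨max 0 R, le_max_left _ _, fun v hv => le_max_of_le_right (hR ⟨v, hv, rfl⟩)⟩

theorem CurvedGraph.netFlow_sq {w : V → V → ℝ} {m : V → ℝ} {d : V → V → ℝ}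
    (G : CurvedGraph w m d) (φ : V → ℝ) (x : V) :
    netFlow w (fun v => φ v ^ 2) x =
      ∑ y ∈ (G.locFin x).toFinset, w x y * (φ y - φ x) ^ 2 + 2 * φ x * netFlow w φ x := by
  rw [G.netFlow_nbrs, G.netFlow_nbrs, Finset.mul_sum, ← Finset.sum_add_distrib]
  exact Finset.sum_congr rfl fun y _ => by ring

namespace HarmonicProfile

variable {w : V → V → ℝ} {m : V → ℝ} {d : V → V → ℝ} {X Y K : Set V} {g : V → ℝ}

theorem not_two_ends_of_infVolume (H : HarmonicProfile w m d X Y K g) {t : ℝ}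
    (hdeep : ∀ v, g v < t → v ∈ X) {X₁ X₂ : Set V} (hcov : ∀ v, g v < t ↔ v ∈ X₁ ∨ v ∈ X₂)
    (hdisj : ∀ v ∈ X₁, v ∉ X₂) (hadj : ∀ x ∈ X₁, ∀ y ∈ X₂, w x y = 0)
    (h₁ : X₁.Nonempty) (h₂ : X₂.Nonempty) (hvol : InfVolume m X₁) : False := by
  classical
  have S := H.part.separates
  have hX₁ : ∀ v ∈ X₁, v ∈ X := fun v hv => hdeep v ((hcov v).2 (Or.inl hv))
  have hX₂ : ∀ v ∈ X₂, v ∈ X := fun v hv => hdeep v ((hcov v).2 (Or.inr hv))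
  obtain ⟨x₁, hx₁⟩ := h₁
  obtain ⟨x₂, hx₂⟩ := h₂
  obtain ⟨R, hR, hB⟩ := exists_ball_superset d
    (S.fin.union (H.graph.finite_superlevel S H.ext t)) x₂
  have P := H.graph.salamiPartition_of_cover (X := X₁) (Y := X₂ ∪ Y) (H.graph.finite_ball x₂ R)
    (fun v => by
      rcases S.cover v with h | h | h
      · by_cases hv : g v < t
        · rcases (hcov v).1 hv with h | h
          · exact Or.inl h
          · exact Or.inr (Or.inl (Or.inl h))
        · exact Or.inr (Or.inr (hB (Or.inr ⟨h, not_lt.1 hv⟩)))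
      · exact Or.inr (Or.inl (Or.inr h))
      · exact Or.inr (Or.inr (hB (Or.inl h))))
    (fun v hv h => h.elim (hdisj v hv) (S.disjXY v (hX₁ v hv)))
    (fun x hx y hy => hy.elim (hadj x hx y) (S.nonadj x (hX₁ x hx) y))
    hvol (H.part.2.2.2.2.2.2.2.mono Set.subset_union_right)
  obtain ⟨g₁, hE₁, hg₁⟩ := H.graph.exists_harmonic_extremal hR P
  obtain ⟨M, -, hM1, hM2⟩ := H.graph.exists_asymptotics S H.ext x₂
  obtain ⟨M₁, -, hM3, hM4⟩ := H.graph.exists_asymptotics P.separates hE₁ x₂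
  have hadjle : ∀ x y, 0 < w x y → |g y - g x| ≤ 1 := fun x y h => H.abs_sub_le_one h
  have hedge : ∀ x ∈ X₂, ∀ y, y ∉ X₂ → 0 < w x y → g x < t ∧ t ≤ g y := by
    intro x hx y hy hxy
    refine ⟨(hcov x).2 (Or.inr hx), ?_⟩
    by_contra! hlt
    rcases (hcov y).1 hlt with h | h
    · exact absurd (H.graph.adj_symm hxy) (by simp [hadj y h x hx])
    · exact hy h
  have ha : 0 ≤ |t| + 2 := by positivity
  have hsum := H.bdFlow_eq_zero ha (A := X₂) (θ := fun v => g₁ v + g v) (M := M + M₁)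
    (fun x hx y hy hxy => by
      obtain ⟨h1, h2⟩ := hedge x hx y hy hxy
      have h3 := abs_le.1 (hadjle x y hxy)
      have h4 := abs_le.1 (le_refl |t|)
      rw [abs_le]
      constructor <;> linarith)
    (fun x _ => by
      rw [H.graph.netFlow_add, H.harm, (H.graph.netFlow_eq_zero_iff g₁ x).1 (hg₁ x), add_zero])
    (fun x hx => by
      have h1 := abs_le.1 (hM1 x (S.disjXY x (hX₂ x hx)))
      have h2 := abs_le.1 (hM4 x fun h => hdisj x h.1 hx)
      rw [abs_le]
      constructor <;> linarith)
  have hdiff := H.bdFlow_eq_zero ha (A := X₂ᶜ) (θ := fun v => g₁ v - g v) (M := M + M₁)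
    (fun x hx y hy hxy => by
      obtain ⟨h1, h2⟩ := hedge y (not_not.1 hy) x hx (H.graph.adj_symm hxy)
      have h3 := abs_le.1 (hadjle x y hxy)
      have h4 := abs_le.1 (le_refl |t|)
      rw [abs_le]
      constructor <;> linarith)
    (fun x _ => by
      rw [H.graph.netFlow_sub, H.harm, (H.graph.netFlow_eq_zero_iff g₁ x).1 (hg₁ x), sub_zero])
    (fun x hx => by
      by_cases hY : x ∈ Y
      · have h1 := abs_le.1 (hM2 x fun h => S.disjXY x h hY)
        have h2 := abs_le.1 (hM4 x fun h => S.disjXY x (hX₁ x h.1) hY)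
        rw [abs_le]
        constructor <;> linarith
      · have h1 := abs_le.1 (hM1 x hY)
        have h2 := abs_le.1 (hM3 x fun h => h.1.elim hx hY)
        rw [abs_le]
        constructor <;> linarith)
  rw [bdFlow_compl H.graph.symm, neg_eq_zero] at hdiff
  have hzero : bdFlow w (H.level (|t| + 2)) X₂ (fun v => 2 * g v) = 0 := by
    have := bdFlow_sub w (H.level (|t| + 2)) X₂ (fun v => g₁ v + g v) (fun v => g₁ v - g v)
    rw [hsum, hdiff, sub_zero] at this
    rw [← this]
    congr 1
    ext v
    ring
  rw [bdFlow_const_mul] at hzero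
  have hpos : 0 < bdFlow w (H.level (|t| + 2)) X₂ g := by
    have hnn : ∀ x y, 0 ≤ if x ∈ X₂ ∧ y ∉ X₂ then w x y * (g y - g x) else 0 := by
      intro x y
      split_ifs with h
      · rcases (H.graph.nonneg x y).eq_or_lt with h0 | h0
        · rw [← h0, zero_mul]
        · obtain ⟨h1, h2⟩ := hedge x h.1 y h.2 h0
          exact mul_nonneg h0.le (by linarith)
      · exact le_rfl
    obtain ⟨x, hx, y, hy, hxy⟩ := H.graph.exists_boundary_edge hx₂ (hdisj x₁ hx₁)
    obtain ⟨h1, h2⟩ := hedge x hx y hy hxy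
    have h3 := abs_le.1 (hadjle x y hxy)
    have h4 := abs_le.1 (le_refl |t|)
    refine Finset.sum_pos' (fun x _ => Finset.sum_nonneg fun y _ => hnn x y)
      ⟨x, H.mem_level.2 (abs_le.2 ⟨by linarith, by linarith⟩),
        Finset.sum_pos' (fun y _ => hnn x y)
        ⟨y, H.mem_level.2 (abs_le.2 ⟨by linarith, by linarith⟩), ?_⟩⟩
    rw [if_pos ⟨hx, hy⟩]
    exact mul_pos hxy (by linarith)
  linarith

/-- A deep sublevel set of `g` cannot split into two pieces. -/
theorem not_two_ends (H : HarmonicProfile w m d X Y K g) {t : ℝ}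
    (hdeep : ∀ v, g v < t → v ∈ X) {X₁ X₂ : Set V} (hcov : ∀ v, g v < t ↔ v ∈ X₁ ∨ v ∈ X₂)
    (hdisj : ∀ v ∈ X₁, v ∉ X₂) (hadj : ∀ x ∈ X₁, ∀ y ∈ X₂, w x y = 0)
    (h₁ : X₁.Nonempty) (h₂ : X₂.Nonempty) : False := by
  have hvol : InfVolume m (X₁ ∪ X₂) := by
    refine (H.graph.infVolume_sdiff H.part.2.2.2.2.2.2.1
      (H.graph.finite_superlevel H.part.separates H.ext t)).mono fun v hv => ?_
    refine (hcov v).1 ?_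
    by_contra! h
    exact hv.2 ⟨hv.1, h⟩
  rcases infVolume_union hvol with h | h
  · exact H.not_two_ends_of_infVolume hdeep hcov hdisj hadj h₁ h₂ h
  · exact H.not_two_ends_of_infVolume hdeep (fun v => (hcov v).trans or_comm)
      (fun v h h' => hdisj v h' h) (fun x hx y hy => by rw [H.graph.symm]; exact hadj y hy x hx)
      h₂ h₁ h

/-- Steepest ascent from below reaches the slab `{t ≤ g < t + 1}`. -/
theorem exists_tight_up (H : HarmonicProfile w m d X Y K g) {t : ℝ}
    (hdeep : ∀ v, g v < t → v ∈ X) {x : V} (hx : g x < t + 1) :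
    ∃ u, (t ≤ g u ∧ g u < t + 1) ∧ g u - g x = d x u := by
  rcases le_or_gt t (g x) with h | h
  · exact ⟨x, ⟨h, hx⟩, by simp [H.graph.dist_self]⟩
  obtain ⟨k, hk, hkx⟩ := H.ext.up x (hdeep x h)
  have hgk : t ≤ g k := by
    by_contra! hlt
    exact H.part.separates.disjXK k (hdeep k hlt) hk
  obtain ⟨n, hn⟩ := H.graph.dist_nat x k
  have hceil : (⌈t - g x⌉₊ : ℝ) ≤ d x k := by
    rw [hn]
    exact_mod_cast Nat.ceil_le.2 (by linarith)
  obtain ⟨u, hu1, hu2⟩ := H.graph.exists_between x k _ hceil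
  have h1 := H.ext.lip x u
  have h2 := H.ext.lip u k
  have h3 := Nat.le_ceil (t - g x)
  have h4 := Nat.ceil_lt_add_one (a := t - g x) (by linarith)
  exact ⟨u, ⟨by linarith, by linarith⟩, by linarith⟩

/-- A deep slab of `g` does not split into two distant clusters. -/
theorem not_two_clusters (H : HarmonicProfile w m d X Y K g) {t : ℝ}
    (hdeep : ∀ v, g v < t + 2 → v ∈ X) {K₁ K₂ : Set V}
    (hcov : ∀ v, (t ≤ g v ∧ g v < t + 1) ↔ v ∈ K₁ ∨ v ∈ K₂)
    (hgap : ∀ k ∈ K₁, ∀ k' ∈ K₂, 4 ≤ d k k') (h₁ : K₁.Nonempty) (h₂ : K₂.Nonempty) : False := by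
  classical
  have G := H.graph
  have hdeep' : ∀ v, g v < t → v ∈ X := fun v hv => hdeep v (by linarith)
  set S₀ : Set V := {v | t ≤ g v ∧ g v < t + 1} with hS₀
  have hadj : ∀ x y, 0 < w x y → g y ≤ g x + 1 := fun x y h => by
    linarith [(abs_le.1 (H.abs_sub_le_one h)).2]
  have hadj' : ∀ x y, 0 < w x y → g x ≤ g y + 1 := fun x y h => hadj y x (G.adj_symm h)
  have S : Separates w {v | g v < t} {v | t + 1 ≤ g v} S₀ := by
    refine ⟨fun v => ?_, fun v h h' => ?_, fun v h h' => ?_, fun v h h' => ?_, ?_,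
      fun x hx y hy => ?_⟩
    · rcases lt_or_ge (g v) t with h | h
      · exact Or.inl h
      · rcases lt_or_ge (g v) (t + 1) with h' | h'
        · exact Or.inr (Or.inr ⟨h, h'⟩)
        · exact Or.inr (Or.inl h')
    · have h1 : g v < t := h
      have h2 : t + 1 ≤ g v := h'
      linarith
    · have h1 : g v < t := h
      linarith [h'.1]
    · have h2 : t + 1 ≤ g v := h
      linarith [h'.2]
    · refine (H.finite_level (|t| + 1)).subset fun v hv => ?_
      obtain ⟨h1, h2⟩ : t ≤ g v ∧ g v < t + 1 := hv
      obtain ⟨h3, h4⟩ := abs_le.1 (le_refl |t|)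
      exact show |g v| ≤ |t| + 1 from abs_le.2 ⟨by linarith, by linarith⟩
    · have h1 : g x < t := hx
      have h2 : t + 1 ≤ g y := hy
      by_contra hne
      linarith [hadj x y (lt_of_le_of_ne (G.nonneg x y) (Ne.symm hne))]
  have hdisj : ∀ v ∈ K₁, v ∉ K₂ := fun v hv hv' => by
    have := hgap v hv v hv'
    rw [G.dist_self] at this
    linarith
  have hnear : ∀ k ∈ K₂, ∀ k', t ≤ g k' → g k' < t + 1 → d k k' < 4 → k' ∈ K₂ := by
    intro k hk k' h h' hd
    refine ((hcov k').1 ⟨h, h'⟩).resolve_left fun h1 => ?_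
    have := hgap k' h1 k hk
    rw [G.dist_comm] at this
    linarith
  set f : V → ℝ := fun v => g v + if v ∈ K₂ then 1 else 0 with hf
  have hf₂ : ∀ k ∈ K₂, f k = g k + 1 := fun k hk => by simp [hf, hk]
  have hf₁ : ∀ k, k ∉ K₂ → f k = g k := fun k hk => by simp [hf, hk]
  have hfg : ∀ k, g k ≤ f k ∧ f k ≤ g k + 1 := by
    intro k
    by_cases hk : k ∈ K₂
    · rw [hf₂ k hk]; exact ⟨by linarith, le_rfl⟩
    · rw [hf₁ k hk]; exact ⟨le_rfl, by linarith⟩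
  have hfLip : Lip1On d S₀ f := by
    intro k hk k' hk'
    have hlip := H.ext.lip k k'
    by_cases h : k ∈ K₂
    · rw [hf₂ k h]
      linarith [(hfg k').2]
    · by_cases h' : k' ∈ K₂
      · have h1 := hgap k (((hcov k).1 hk).resolve_right h) k' h'
        linarith [(hfg k').2, (hfg k).1, hk.1, hk'.2]
      · rw [hf₁ k h, hf₁ k' h']
        exact hlip
  obtain ⟨k₁, hk₁⟩ := id h₁
  obtain ⟨ψ, hE, hψ⟩ := G.exists_extension S ⟨k₁, (hcov k₁).2 (Or.inl hk₁)⟩ hfLip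
  have hge : ∀ v, g v ≤ ψ v := by
    intro v
    rcases S.cover v with h | h | h
    · have h0 : g v < t := h
      obtain ⟨u, hu, hgu⟩ := H.exists_tight_up hdeep' (x := v) (by linarith)
      have h1 := hE.lip v u
      rw [hψ u hu] at h1
      linarith [(hfg u).1]
    · obtain ⟨k, hk, hkv⟩ := hE.down v h
      rw [hψ k hk] at hkv
      linarith [(hfg k).1, H.ext.lip k v]
    · rw [hψ v h]
      exact (hfg v).1
  have hle : ∀ v, g v < t + 1 → ψ v ≤ g v + 1 := by
    intro v hv
    rcases lt_or_ge (g v) t with h | h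
    · obtain ⟨k, hk, hkv⟩ := hE.up v h
      rw [hψ k hk] at hkv
      linarith [(hfg k).2, H.ext.lip v k]
    · rw [hψ v ⟨h, hv⟩]
      exact (hfg v).2
  have hnbr₂ : ∀ k ∈ K₂, ∀ y, 0 < w k y → g y + 1 ≤ ψ y := by
    intro k hk y hky
    have hkS := (hcov k).2 (Or.inr hk)
    have hd1 := G.dist_adj k y hky
    rcases S.cover y with h | h | h
    · have h0 : g y < t := h
      obtain ⟨u, hu, hgu⟩ := H.exists_tight_up hdeep' (x := y) (by linarith)
      have h1 := hadj' k y hky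
      have hu2 : u ∈ K₂ := hnear k hk u hu.1 hu.2 (by
        linarith [G.dist_triangle k y u, hu.2, hkS.1])
      have h2 := hE.lip y u
      rw [hψ u hu, hf₂ u hu2] at h2
      linarith
    · obtain ⟨k', hk', hkv⟩ := hE.down y h
      rw [hψ k' hk'] at hkv
      by_cases h2 : k' ∈ K₂
      · rw [hf₂ k' h2] at hkv
        linarith [H.ext.lip k' y]
      · rw [hf₁ k' h2] at hkv
        have h3 := hgap k' (((hcov k').1 hk').resolve_right h2) k hk
        have h4 := G.dist_triangle k' y k
        rw [G.dist_comm y k] at h4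
        linarith [hadj k y hky, hk'.1, hkS.2]
    · have hy : y ∈ K₂ := hnear k hk y h.1 h.2 (by linarith)
      rw [hψ y h, hf₂ y hy]
  have hnbr₁ : ∀ k ∈ K₁, ∀ y, 0 < w k y → g y < t → ψ y ≤ g y := by
    intro k hk y hky h
    have hkS := (hcov k).2 (Or.inl hk)
    have hd1 := G.dist_adj k y hky
    obtain ⟨k', hk', hkv⟩ := hE.up y h
    rw [hψ k' hk'] at hkv
    by_cases h2 : k' ∈ K₂
    · rw [hf₂ k' h2] at hkv
      have h3 := hgap k hk k' h2
      have h4 := G.dist_triangle k y k'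
      linarith [hadj' k y hky, hk'.2, hkS.1]
    · rw [hf₁ k' h2] at hkv
      linarith [H.ext.lip y k']
  have hlapS : ∀ k ∈ S₀, 0 ≤ lap w m ψ k := by
    intro k hk
    rw [G.lap_nonneg_iff, ← H.harm k, G.netFlow_nbrs, G.netFlow_nbrs]
    refine Finset.sum_le_sum fun y hy => ?_
    have hky : 0 < w k y := by simpa using hy
    refine mul_le_mul_of_nonneg_left ?_ hky.le
    by_cases h2 : k ∈ K₂
    · rw [hψ k hk, hf₂ k h2]
      linarith [hnbr₂ k h2 y hky]
    · rw [hψ k hk, hf₁ k h2]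
      linarith [hge y]
  set φ : V → ℝ := fun v => ψ v - g v with hφ
  have hflow : ∀ x ∈ {v | g v < t}, 0 ≤ netFlow w φ x := by
    intro x hx
    obtain ⟨k, hk, hkx⟩ := hE.up x hx
    rw [hφ, G.netFlow_sub, H.harm, sub_zero, ← G.lap_nonneg_iff (m := m)]
    exact (hlapS k hk).trans (G.lap_le_of_tight hE.lip hkx)
  have hφ0 : ∀ v, 0 ≤ φ v := fun v => sub_nonneg.2 (hge v)
  have hφ1 : ∀ v, g v < t + 1 → φ v ≤ 1 := fun v hv => by
    simp only [hφ]
    linarith [hle v hv]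
  have hΓ : ∀ x ∈ {v | g v < t}, ∑ y ∈ (G.locFin x).toFinset, w x y * (φ y - φ x) ^ 2 ≤
      netFlow w (fun v => φ v ^ 2) x := by
    intro x hx
    rw [G.netFlow_sq]
    nlinarith [mul_nonneg (hφ0 x) (hflow x hx)]
  have hΓ0 : ∀ x, 0 ≤ ∑ y ∈ (G.locFin x).toFinset, w x y * (φ y - φ x) ^ 2 := fun x =>
    Finset.sum_nonneg fun y _ => mul_nonneg (G.nonneg _ _) (sq_nonneg _)
  have hbdeq : ∀ x y, 0 < w x y → g x < t → t ≤ g y → φ y = φ x := by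
    intro x y hxy hx hy
    have hy1 : g y < t + 1 := by linarith [hadj x y hxy]
    have hyx := G.adj_symm hxy
    by_cases h2 : y ∈ K₂
    · simp only [hφ]
      rw [hψ y ⟨hy, hy1⟩, hf₂ y h2]
      linarith [hnbr₂ y h2 x hyx, hle x (by linarith)]
    · simp only [hφ]
      rw [hψ y ⟨hy, hy1⟩, hf₁ y h2]
      linarith [hnbr₁ y (((hcov y).1 ⟨hy, hy1⟩).resolve_right h2) x hyx hx, hge x]
  have hconst : ∀ x y, g x < t → 0 < w x y → φ y = φ x := by
    intro x y hx hxy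
    have ht := abs_le.1 (le_refl |t|)
    set a := max (|t| + 2) |g x| with ha
    have ha0 : 0 ≤ a := le_max_of_le_right (abs_nonneg _)
    have ha1 : |t| + 2 ≤ a := le_max_left _ _
    have hsum := H.sum_netFlow_le_bdFlow ha0 (A := {v | g v < t}) (θ := fun v => φ v ^ 2) (M := 1)
      (fun u hu v hv huv => by
        have h1 : g u < t := hu
        have h2 : t ≤ g v := not_lt.1 hv
        rw [abs_le]
        constructor <;> linarith [hadj u v huv])
      (fun u hu => (hΓ0 u).trans (hΓ u hu))
      (fun u hu => by
        have h1 : g u < t := hu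
        rw [abs_of_nonneg (sq_nonneg _)]
        exact pow_le_one₀ (hφ0 u) (hφ1 u (by linarith)))
      (F := {x}) (by simpa using ⟨hx, le_max_right _ _⟩)
    have hbd : bdFlow w (H.level a) {v | g v < t} (fun v => φ v ^ 2) = 0 := by
      refine Finset.sum_eq_zero fun u _ => Finset.sum_eq_zero fun v _ => ?_
      split_ifs with h
      · rcases (G.nonneg u v).eq_or_lt with h0 | h0
        · rw [← h0, zero_mul]
        · simp only [hbdeq u v h0 h.1 (not_lt.1 h.2), sub_self, mul_zero]
      · rfl
    rw [hbd, Finset.sum_singleton] at hsum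
    have h0 := le_antisymm ((hΓ x hx).trans hsum) (hΓ0 x)
    have h1 := (Finset.sum_eq_zero_iff_of_nonneg fun y _ =>
      mul_nonneg (G.nonneg x y) (sq_nonneg (φ y - φ x))).1 h0 y (by simpa using hxy)
    have h2 := (mul_eq_zero.1 h1).resolve_left hxy.ne'
    linarith [pow_eq_zero_iff (two_ne_zero) |>.1 h2]
  have hentry : ∀ A : Set V, A ⊆ S₀ → A.Nonempty → (∀ a ∈ A, ∀ y ∈ S₀, 0 < w a y → y ∈ A) →
      ∃ a ∈ A, ∃ y, 0 < w a y ∧ g y < t := by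
    intro A hA hne hcl
    obtain ⟨a, ha, hmin⟩ := Set.exists_min_image A g (S.fin.subset hA) hne
    have haS := hA ha
    obtain ⟨y, hay, hy⟩ := H.exists_lower_nbr (hdeep a (by linarith [haS.2]))
    refine ⟨a, ha, y, hay, ?_⟩
    by_contra! hty
    exact absurd (hmin y (hcl a ha y ⟨hty, by linarith [haS.2]⟩ hay)) (not_le.2 hy)
  refine H.not_two_ends hdeep' (X₁ := {v | g v < t ∧ φ v = 0}) (X₂ := {v | g v < t ∧ φ v ≠ 0})
    (fun v => ?_) (fun v h h' => h'.2 h.2) (fun x hx y hy => ?_) ?_ ?_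
  · simp only [Set.mem_ofPred_eq]
    tauto
  · by_contra hne
    have := hconst x y hx.1 (lt_of_le_of_ne (G.nonneg x y) (Ne.symm hne))
    exact hy.2 (this.trans hx.2)
  · obtain ⟨a, ha, y, hay, hy⟩ := hentry K₁ (fun k hk => (hcov k).2 (Or.inl hk)) h₁
      fun a ha y hy hay => ((hcov y).1 hy).resolve_right fun h => by
        have := hgap a ha y h
        rw [G.dist_adj a y hay] at this
        linarith
    have haS := (hcov a).2 (Or.inl ha)
    refine ⟨y, hy, ?_⟩
    rw [← hbdeq y a (G.adj_symm hay) hy haS.1]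
    simp [hφ, hψ a haS, hf₁ a (hdisj a ha)]
  · obtain ⟨a, ha, y, hay, hy⟩ := hentry K₂ (fun k hk => (hcov k).2 (Or.inr hk)) h₂
      fun a ha y hy hay => hnear a ha y hy.1 hy.2 (by rw [G.dist_adj a y hay]; norm_num)
    have haS := (hcov a).2 (Or.inr ha)
    refine ⟨y, hy, ?_⟩
    rw [← hbdeq y a (G.adj_symm hay) hy haS.1]
    simp [hφ, hψ a haS, hf₂ a ha]

/-- Far down in `X`, points at nearby levels of `g` are at bounded distance. -/
theorem exists_deep_diam_bound (H : HarmonicProfile w m d X Y K g) :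
    ∃ r D, ∀ x y, g x ≤ r → g y ≤ r → |g x - g y| ≤ 3 → d x y ≤ D := by
  classical
  have G := H.graph
  rcases isEmpty_or_nonempty V with _ | ⟨⟨x₀⟩⟩
  · exact ⟨0, 0, fun x => (IsEmpty.false x).elim⟩
  obtain ⟨M, -, -, hM⟩ := G.exists_asymptotics H.part.separates H.ext x₀
  obtain ⟨N, hN⟩ := H.exists_slab_card_le
  have hX : ∀ v, g v < -M → v ∈ X := by
    intro v hv
    by_contra hvX
    linarith [(abs_le.1 (hM v hvX)).1, G.dist_nonneg x₀ v]
  have hslab : ∀ t, t + 2 ≤ -M → ∀ u y, (t ≤ g u ∧ g u < t + 1) → (t ≤ g y ∧ g y < t + 1) →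
      d u y ≤ 4 * N := by
    intro t ht u y hu hy
    by_contra! hfar
    have hfin : {v | t ≤ g v ∧ g v < t + 1}.Finite := by
      refine (H.finite_level (|t| + 1)).subset fun v hv => ?_
      obtain ⟨h1, h2⟩ : t ≤ g v ∧ g v < t + 1 := hv
      obtain ⟨h3, h4⟩ := abs_le.1 (le_refl |t|)
      exact show |g v| ≤ |t| + 1 from abs_le.2 ⟨by linarith, by linarith⟩
    have hgrow : ∀ j : ℕ, j ≤ N → j + 1 ≤ (hfin.toFinset.filter fun v => d u v ≤ 4 * j).card := by
      intro j
      induction j with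
      | zero =>
        intro _
        refine Finset.card_pos.2 ⟨u, Finset.mem_filter.2 ⟨by simpa using hu, ?_⟩⟩
        simp [G.dist_self]
      | succ j ih =>
        intro hj
        have hjN : (j : ℝ) + 1 ≤ N := by exact_mod_cast hj
        have hstep : ∃ k, (t ≤ g k ∧ g k < t + 1) ∧ d u k ≤ 4 * j ∧
            ∃ k', (t ≤ g k' ∧ g k' < t + 1) ∧ 4 * j < d u k' ∧ d k k' < 4 := by
          by_contra! hcon
          refine H.not_two_clusters (t := t) (fun v hv => hX v (by linarith))
            (K₁ := {v | (t ≤ g v ∧ g v < t + 1) ∧ d u v ≤ 4 * j})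
            (K₂ := {v | (t ≤ g v ∧ g v < t + 1) ∧ 4 * j < d u v}) (fun v => ?_)
            (fun k hk k' hk' => hcon k hk.1 hk.2 k' hk'.1 hk'.2)
            ⟨u, hu, by rw [G.dist_self]; positivity⟩ ⟨y, hy, by linarith⟩
          simp only [Set.mem_ofPred_eq, ← and_or_left, le_or_gt, and_true]
        obtain ⟨k, hk, hkj, k', hk', hkj', hkk'⟩ := hstep
        have hss : (hfin.toFinset.filter fun v => d u v ≤ 4 * j) ⊂
            hfin.toFinset.filter fun v => d u v ≤ 4 * ((j + 1 : ℕ) : ℝ) := by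
          refine (Finset.ssubset_iff_of_subset fun v hv => ?_).2 ⟨k', ?_, ?_⟩
          · rw [Finset.mem_filter] at hv ⊢
            exact ⟨hv.1, by push_cast; linarith [hv.2]⟩
          · rw [Finset.mem_filter]
            exact ⟨by simpa using hk', by push_cast; linarith [G.dist_triangle u k k']⟩
          · rw [Finset.mem_filter]
            exact fun h => absurd h.2 (not_le.2 hkj')
        have := Finset.card_lt_card hss
        have := ih (by omega)
        omega
    have h1 := hgrow N le_rfl
    have h2 := hN t (hfin.toFinset.filter fun v => d u v ≤ 4 * N) fun v hv => by
      have := (Set.Finite.mem_toFinset _).1 (Finset.mem_filter.1 hv).1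
      exact ⟨this.1, this.2.le⟩
    omega
  have hmain : ∀ x y, g y ≤ -M - 2 → g x ≤ g y → g y - g x ≤ 3 → d x y ≤ 4 * N + 4 := by
    intro x y hy hxy h3
    obtain ⟨u, hu, hxu⟩ := H.exists_tight_up (t := g y) (x := x)
      (fun v hv => hX v (by linarith)) (by linarith)
    have := hslab (g y) (by linarith) u y hu ⟨le_rfl, by linarith⟩
    linarith [G.dist_triangle x u y, hu.2]
  refine ⟨-M - 2, 4 * N + 4, fun x y hx hy hxy => ?_⟩
  have h1 := abs_le.1 hxy
  rcases le_total (g x) (g y) with h | h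
  · exact hmain x y hy h (by linarith)
  · rw [G.dist_comm]
    exact hmain y x hx h (by linarith)

end HarmonicProfile

section Growth

theorem SubexpGrowth.exists_bound {w : V → V → ℝ} {m : V → ℝ} {d : V → V → ℝ}
    (G : CurvedGraph w m d) {x₀ : V} {u : V → ℝ} (h : SubexpGrowth d x₀ u) {δ : ℝ} (hδ : 0 < δ) :
    ∃ C, 0 ≤ C ∧ ∀ z, |u z| ≤ C * Real.exp (δ * d x₀ z) := by
  obtain ⟨N, hN⟩ := eventually_atTop.1 (h.eventually (gt_mem_nhds hδ))
  refine ⟨Real.exp (δ * (N + 1)), (Real.exp_pos _).le, fun z => ?_⟩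
  obtain ⟨n, hn⟩ := G.dist_nat x₀ z
  have hr := hN (max n (N + 1)) (le_max_of_le_right (Nat.le_succ N))
  set r := max n (N + 1) with hrdef
  have hr0 : (0 : ℝ) < r := by exact_mod_cast lt_of_lt_of_le N.succ_pos (le_max_right _ _)
  set S := {c | ∃ y, d x₀ y ≤ (r : ℝ) ∧ c = |u y|} with hS
  have hbdd : BddAbove S := by
    refine (((G.finite_ball x₀ r).image fun y => |u y|).subset ?_).bddAbove
    rintro c ⟨y, hy, rfl⟩
    exact ⟨y, hy, rfl⟩
  have hle : |u z| ≤ sSup S :=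
    le_csSup hbdd ⟨z, by rw [hn]; exact_mod_cast le_max_left _ _, rfl⟩
  have hexp : Real.exp (δ * r) ≤ Real.exp (δ * (N + 1)) * Real.exp (δ * d x₀ z) := by
    rw [← Real.exp_add, Real.exp_le_exp, ← mul_add, hn]
    refine mul_le_mul_of_nonneg_left ?_ hδ.le
    have : r ≤ N + 1 + n := by omega
    exact_mod_cast this
  refine le_trans ?_ hexp
  rcases (abs_nonneg (u z)).eq_or_lt with h0 | h0
  · rw [← h0]; exact (Real.exp_pos _).le
  · refine hle.trans ((Real.log_le_iff_le_exp (h0.trans_le hle)).1 ?_)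
    exact ((div_lt_iff₀ hr0).1 hr).le

theorem subexpGrowth_of_le_dist {w : V → V → ℝ} {m : V → ℝ} {d : V → V → ℝ}
    (G : CurvedGraph w m d) {x₀ : V} {f : V → ℝ} {C : ℝ} (hf : ∀ z, |f z| ≤ C + d x₀ z)
    {z₀ : V} (hz₀ : f z₀ ≠ 0) : SubexpGrowth d x₀ f := by
  have h0 : 0 < |f z₀| := abs_pos.2 hz₀
  have hC : 0 ≤ C := by
    have := hf x₀
    rw [G.dist_self, add_zero] at this
    exact (abs_nonneg _).trans this
  have hinv : Tendsto (fun r : ℕ => (r : ℝ)) atTop atTop := tendsto_natCast_atTop_atTop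
  have hlow : Tendsto (fun r : ℕ => Real.log |f z₀| / (r : ℝ)) atTop (nhds 0) :=
    tendsto_const_nhds.div_atTop hinv
  have hup : Tendsto (fun r : ℕ => Real.log (C + 1) / (r : ℝ) + Real.log r / r) atTop (nhds 0) := by
    simpa using (tendsto_const_nhds.div_atTop hinv).add
      (Real.isLittleO_log_id_atTop.tendsto_div_nhds_zero.comp hinv)
  obtain ⟨N, hN⟩ := exists_nat_gt (d x₀ z₀)
  have hS : ∀ r : ℕ, N + 1 ≤ r →
      |f z₀| ≤ sSup {c | ∃ y, d x₀ y ≤ (r : ℝ) ∧ c = |f y|} ∧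
      sSup {c | ∃ y, d x₀ y ≤ (r : ℝ) ∧ c = |f y|} ≤ (C + 1) * r := by
    intro r hr
    have hr1 : (N : ℝ) + 1 ≤ r := by exact_mod_cast hr
    have hb : ∀ c ∈ {c | ∃ y, d x₀ y ≤ (r : ℝ) ∧ c = |f y|}, c ≤ (C + 1) * r := by
      rintro c ⟨y, hy, rfl⟩
      have h1 := hf y
      have h2 : (1 : ℝ) ≤ r := by linarith [Nat.cast_nonneg (α := ℝ) N]
      nlinarith
    have hmem : |f z₀| ∈ {c | ∃ y, d x₀ y ≤ (r : ℝ) ∧ c = |f y|} := ⟨z₀, by linarith, rfl⟩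
    exact ⟨le_csSup ⟨_, hb⟩ hmem, csSup_le ⟨_, hmem⟩ hb⟩
  refine tendsto_of_tendsto_of_tendsto_of_le_of_le' hlow hup ?_ ?_
  · filter_upwards [eventually_ge_atTop (N + 1)] with r hr
    exact div_le_div_of_nonneg_right (Real.log_le_log h0 (hS r hr).1) (Nat.cast_nonneg r)
  · filter_upwards [eventually_ge_atTop (N + 1)] with r hr
    have hr0 : (0 : ℝ) < r := by exact_mod_cast lt_of_lt_of_le N.succ_pos hr
    rw [← add_div, ← Real.log_mul (by linarith) hr0.ne']
    exact div_le_div_of_nonneg_right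
      (Real.log_le_log (h0.trans_le (hS r hr).1) (hS r hr).2) hr0.le

end Growth

namespace CurvedGraph

variable {w : V → V → ℝ} {m : V → ℝ} {d : V → V → ℝ}

theorem netFlow_sub_sq (G : CurvedGraph w m d) {v : V → ℝ} {x : V} (hv : netFlow w v x = 0)
    (c : ℝ) : netFlow w (fun z => (v z - c) ^ 2) x = netFlow w (fun z => v z ^ 2) x := by
  rw [G.netFlow_sq (fun z => v z - c), G.netFlow_sq v, hv,
    G.netFlow_sub v (fun _ => c), netFlow_const, hv]
  simp

theorem weight_mul_sq_le (G : CurvedGraph w m d) {v : V → ℝ} {x : V} (hv : netFlow w v x = 0)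
    (y : V) : w x y * (v y - v x) ^ 2 ≤ netFlow w (fun z => v z ^ 2) x := by
  rw [G.netFlow_sq v, hv, mul_zero, add_zero]
  by_cases h : 0 < w x y
  · exact Finset.single_le_sum (f := fun y => w x y * (v y - v x) ^ 2)
      (fun z _ => mul_nonneg (G.nonneg _ _) (sq_nonneg _)) (by simpa using h)
  · rw [le_antisymm (not_lt.1 h) (G.nonneg x y), zero_mul]
    exact Finset.sum_nonneg fun z _ => mul_nonneg (G.nonneg _ _) (sq_nonneg _)

theorem netFlow_sq_nonneg (G : CurvedGraph w m d) {v : V → ℝ} {x : V} (hv : netFlow w v x = 0) :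
    0 ≤ netFlow w (fun z => v z ^ 2) x := by
  simpa using G.weight_mul_sq_le hv x

/-- The oscillation of a harmonic function along a geodesic is controlled by its energy. -/
theorem sq_sub_le_energy (G : CurvedGraph w m d) {ε : ℝ} (hε : 0 < ε)
    (hw : ∀ x y, 0 < w x y → ε ≤ w x y) {v : V → ℝ} (hv : ∀ x, netFlow w v x = 0)
    {F : Finset V} {x y : V} (hF : ∀ z, d z y ≤ d x y → z ∈ F) :
    (v x - v y) ^ 2 ≤ d x y ^ 2 / ε * ∑ z ∈ F, netFlow w (fun z => v z ^ 2) z := by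
  set S := ∑ z ∈ F, netFlow w (fun z => v z ^ 2) z with hS
  have hS0 : 0 ≤ S / ε := div_nonneg (Finset.sum_nonneg fun z _ => G.netFlow_sq_nonneg (hv z)) hε.le
  have key : (∀ z, d z y ≤ d x y → z ∈ F) → |v x - v y| ≤ d x y * Real.sqrt (S / ε) := by
    refine G.geodesic_induction y
      (p := fun x => (∀ z, d z y ≤ d x y → z ∈ F) → |v x - v y| ≤ d x y * Real.sqrt (S / ε))
      (fun _ => by simp [G.dist_self]) (fun x z hxz hz ih hx => ?_) x
    have h1 := ih fun u hu => hx u (by linarith)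
    have h2 : |v z - v x| ≤ Real.sqrt (S / ε) := by
      refine Real.abs_le_sqrt ?_
      rw [le_div_iff₀ hε]
      calc (v z - v x) ^ 2 * ε ≤ w x z * (v z - v x) ^ 2 := by
            rw [mul_comm]
            exact mul_le_mul_of_nonneg_right (hw x z hxz) (sq_nonneg _)
        _ ≤ netFlow w (fun z => v z ^ 2) x := G.weight_mul_sq_le (hv x) z
        _ ≤ S := Finset.single_le_sum (f := fun u => netFlow w (fun z => v z ^ 2) u)
            (fun u _ => G.netFlow_sq_nonneg (hv u)) (hx x le_rfl)
    have h3 := _root_.abs_sub_le (v x) (v z) (v y)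
    rw [abs_sub_comm (v x) (v z)] at h3
    rw [hz] at h1
    linarith
  have h := key hF
  calc (v x - v y) ^ 2 = |v x - v y| ^ 2 := (sq_abs _).symm
    _ ≤ (d x y * Real.sqrt (S / ε)) ^ 2 := pow_le_pow_left₀ (abs_nonneg _) h 2
    _ = d x y ^ 2 / ε * S := by rw [mul_pow, Real.sq_sqrt hS0]; ring

end CurvedGraph

namespace HarmonicProfile

variable {w : V → V → ℝ} {m : V → ℝ} {d : V → V → ℝ} {X Y K : Set V} {g : V → ℝ}

theorem abs_lt_one_of_crossing (H : HarmonicProfile w m d X Y K g) {x y : V} (hx : 0 ≤ g x)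
    (hy : ¬0 ≤ g y) (h : 0 < w x y) : |g x| < 1 ∧ |g y| ≤ 1 := by
  obtain ⟨h1, h2⟩ := abs_le.1 (H.abs_sub_le_one h)
  rw [not_le] at hy
  rw [abs_of_nonneg hx, abs_of_neg hy]
  constructor <;> linarith

theorem bdFlow_level (H : HarmonicProfile w m d X Y K g) {T : ℝ} (hT : 1 ≤ T) (θ : V → ℝ) :
    bdFlow w (H.level T) {v | 0 ≤ g v} θ = bdFlow w (H.level 1) {v | 0 ≤ g v} θ := by
  have hsub : H.level 1 ⊆ H.level T := fun v hv =>
    H.mem_level.2 ((H.mem_level.1 hv).trans hT)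
  have hz : ∀ x y, (x ∉ H.level 1 ∨ y ∉ H.level 1) → 0 ≤ g x ∧ ¬0 ≤ g y → w x y = 0 := by
    intro x y hxy ⟨h1, h2⟩
    by_contra hne
    obtain ⟨h3, h4⟩ :=
      H.abs_lt_one_of_crossing h1 h2 (lt_of_le_of_ne (H.graph.nonneg x y) (Ne.symm hne))
    rw [H.mem_level, H.mem_level] at hxy
    rcases hxy with h | h
    · exact h h3.le
    · exact h h4
  unfold bdFlow
  symm
  refine (Finset.sum_congr rfl fun x _ => ?_).trans (Finset.sum_subset hsub fun x _ hx => ?_)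
  · refine Finset.sum_subset hsub fun y _ hy => ?_
    split_ifs with h
    · rw [hz x y (Or.inr hy) h, zero_mul]
    · rfl
  · refine Finset.sum_eq_zero fun y _ => ?_
    split_ifs with h
    · rw [hz x y (Or.inl hx) h, zero_mul]
    · rfl

/-- Caccioppoli inequality for harmonic functions without flow between the two ends. -/
theorem exists_caccioppoli (H : HarmonicProfile w m d X Y K g) :
    ∃ C, 0 < C ∧ ∀ v : V → ℝ, (∀ x, netFlow w v x = 0) →
      bdFlow w (H.level 1) {v | 0 ≤ g v} v = 0 → ∀ T M c c' : ℝ, 2 ≤ T → 0 ≤ M →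
      (∀ x, T - 1 ≤ |g x| → |g x| ≤ T + 2 → 0 ≤ g x → (v x - c) ^ 2 ≤ M) →
      (∀ x, T - 1 ≤ |g x| → |g x| ≤ T + 2 → g x < 0 → (v x - c') ^ 2 ≤ M) →
      ∑ x ∈ H.level T, netFlow w (fun z => v z ^ 2) x ≤ C * M := by
  classical
  obtain ⟨C, hC, hcut⟩ := H.exists_cutoff_green
  refine ⟨2 * C + 1, by linarith, fun v hv hfl T M c c' hT hM hc hc' => ?_⟩
  set A : Set V := {v | 0 ≤ g v} with hA
  have h1 := hcut T 1 (by linarith) one_pos A (fun z => (v z - c) ^ 2) M hM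
    (fun x hx y hy hxy => by linarith [(H.abs_lt_one_of_crossing hx hy hxy).1])
    (fun x _ => by rw [H.graph.netFlow_sub_sq (hv x)]; exact H.graph.netFlow_sq_nonneg (hv x))
    (fun x hx h1 h2 => by
      rw [abs_of_nonneg (sq_nonneg _)]
      exact hc x h1 (by linarith) hx)
    ((H.level T).filter (· ∈ A))
    (fun x hx => by
      rw [Finset.mem_filter, H.mem_level] at hx
      exact ⟨hx.2, hx.1⟩)
  have h2 := hcut T 1 (by linarith) one_pos Aᶜ (fun z => (v z - c') ^ 2) M hM
    (fun x hx y hy hxy => by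
      linarith [(H.abs_lt_one_of_crossing (not_not.1 hy) hx (H.graph.adj_symm hxy)).2])
    (fun x _ => by rw [H.graph.netFlow_sub_sq (hv x)]; exact H.graph.netFlow_sq_nonneg (hv x))
    (fun x hx h1 h2 => by
      rw [abs_of_nonneg (sq_nonneg _)]
      exact hc' x h1 (by linarith) (not_le.1 hx))
    ((H.level T).filter (¬· ∈ A))
    (fun x hx => by
      rw [Finset.mem_filter, H.mem_level] at hx
      exact ⟨hx.2, hx.1⟩)
  simp only [H.graph.netFlow_sub_sq (hv _)] at h1 h2
  rw [bdFlow_compl H.graph.symm] at h2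
  have h3 : bdFlow w (H.level T) A (fun z => (v z - c) ^ 2) -
      bdFlow w (H.level T) A (fun z => (v z - c') ^ 2) = 0 := by
    rw [← bdFlow_sub, H.bdFlow_level (by linarith)]
    calc bdFlow w (H.level 1) A (fun z => (v z - c) ^ 2 - (v z - c') ^ 2)
        = bdFlow w (H.level 1) A (fun z => 2 * (c' - c) * v z) := by
          unfold bdFlow
          refine Finset.sum_congr rfl fun x _ => Finset.sum_congr rfl fun y _ => ?_
          split_ifs <;> ring
      _ = 0 := by rw [bdFlow_const_mul, hfl, mul_zero]
  rw [← Finset.sum_filter_add_sum_filter_not (H.level T) (· ∈ A)]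
  rw [div_one] at h1 h2
  linarith

theorem exists_energy_le (H : HarmonicProfile w m d X Y K g) :
    ∃ C, 0 ≤ C ∧ ∀ v : V → ℝ, (∀ x, netFlow w v x = 0) → ∀ T B : ℝ, 0 ≤ T →
      (∀ x, |g x| ≤ T + 2 → |v x| ≤ B) →
      ∑ x ∈ H.level T, netFlow w (fun z => v z ^ 2) x ≤ C * B ^ 2 := by
  obtain ⟨C, hC, hcut⟩ := H.exists_cutoff_green
  refine ⟨C, hC, fun v hv T B hT hB => ?_⟩
  have h := hcut T 1 hT one_pos Set.univ (fun z => v z ^ 2) (B ^ 2) (sq_nonneg _)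
    (fun x _ y hy => absurd (Set.mem_univ y) hy) (fun x _ => H.graph.netFlow_sq_nonneg (hv x))
    (fun x _ _ h2 => by
      rw [abs_of_nonneg (sq_nonneg _), ← sq_abs]
      exact pow_le_pow_left₀ (abs_nonneg _) (hB x (by linarith)) 2)
    (H.level T) (fun x hx => ⟨Set.mem_univ x, H.mem_level.1 hx⟩)
  have h0 : bdFlow w (H.level T) Set.univ (fun z => v z ^ 2) = 0 := by simp [bdFlow]
  rwa [h0, zero_add, div_one] at h

end HarmonicProfile

theorem exists_center {p : V → Prop} {v : V → ℝ} {M : ℝ}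
    (h : ∀ x y, p x → p y → (v x - v y) ^ 2 ≤ M) : ∃ c, ∀ x, p x → (v x - c) ^ 2 ≤ M := by
  by_cases hp : ∃ y, p y
  · obtain ⟨y, hy⟩ := hp
    exact ⟨v y, fun x hx => h x y hx hy⟩
  · exact ⟨0, fun x hx => absurd ⟨x, hx⟩ hp⟩

namespace HarmonicProfile

variable {w : V → V → ℝ} {m : V → ℝ} {d : V → V → ℝ} {X Y K : Set V} {g : V → ℝ}

theorem exists_end_diam_bound (H : HarmonicProfile w m d X Y K g) :
    ∃ r D, 0 ≤ r ∧ 0 ≤ D ∧ ∀ x y, (g x ≤ -r ∧ g y ≤ -r ∨ r ≤ g x ∧ r ≤ g y) →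
      |g x - g y| ≤ 3 → d x y ≤ D := by
  obtain ⟨r, D, h⟩ := H.exists_deep_diam_bound
  obtain ⟨r', D', h'⟩ := H.neg.exists_deep_diam_bound
  have h1 := neg_abs_le r
  have h2 := neg_abs_le r'
  have h3 := abs_nonneg r
  have h4 := abs_nonneg r'
  refine ⟨|r| + |r'|, |D| + |D'|, by positivity, by positivity, fun x y hxy hle => ?_⟩
  rcases hxy with ⟨hx, hy⟩ | ⟨hx, hy⟩
  · linarith [h x y (by linarith) (by linarith) hle, le_abs_self D, abs_nonneg D']
  · refine (h' x y (by linarith) (by linarith) ?_).trans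
      (by linarith [le_abs_self D', abs_nonneg D])
    rwa [neg_sub_neg, abs_sub_comm]

/-- The energy of a harmonic function without flow between the ends grows geometrically. -/
theorem exists_energy_growth (H : HarmonicProfile w m d X Y K g) :
    ∃ k q s₀ : ℝ, 0 < k ∧ 1 < q ∧ 0 ≤ s₀ ∧ ∀ v : V → ℝ, (∀ x, netFlow w v x = 0) →
      bdFlow w (H.level 1) {v | 0 ≤ g v} v = 0 → ∀ s, s₀ ≤ s →
      q * ∑ x ∈ H.level s, netFlow w (fun z => v z ^ 2) x ≤
        ∑ x ∈ H.level (s + k), netFlow w (fun z => v z ^ 2) x := by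
  classical
  obtain ⟨C, hC, hcac⟩ := H.exists_caccioppoli
  obtain ⟨r, D, hr, hD, hdiam⟩ := H.exists_end_diam_bound
  obtain ⟨ε, hε, hw⟩ := H.weight_low
  set C' := C * (D ^ 2 / ε) with hC'
  have hC'0 : 0 ≤ C' := by positivity
  refine ⟨2 * D + 4, 1 + 1 / (C' + 1), r, by linarith, by simp; positivity, hr,
    fun v hv hfl s hs => ?_⟩
  have hΓ : ∀ x, 0 ≤ netFlow w (fun z => v z ^ 2) x := fun x => H.graph.netFlow_sq_nonneg (hv x)
  set E : ℝ → ℝ := fun t => ∑ x ∈ H.level t, netFlow w (fun z => v z ^ 2) x with hE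
  have hsub : ∀ a b, a ≤ b → H.level a ⊆ H.level b := fun a b hab z hz =>
    H.mem_level.2 ((H.mem_level.1 hz).trans hab)
  have hmono : ∀ a b, a ≤ b → E a ≤ E b := fun a b hab =>
    Finset.sum_le_sum_of_subset_of_nonneg (hsub a b hab) fun x _ _ => hΓ x
  set F := H.level (s + (2 * D + 4)) \ H.level s with hF
  have hFsum : ∑ x ∈ F, netFlow w (fun z => v z ^ 2) x = E (s + (2 * D + 4)) - E s :=
    eq_sub_of_add_eq (Finset.sum_sdiff (hsub s _ (by linarith)))
  set T := s + 2 + D with hT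
  have hosc : ∀ x y, (T - 1 ≤ |g x| ∧ |g x| ≤ T + 2) → (T - 1 ≤ |g y| ∧ |g y| ≤ T + 2) →
      (0 ≤ g x ∧ 0 ≤ g y ∨ g x < 0 ∧ g y < 0) →
      (v x - v y) ^ 2 ≤ D ^ 2 / ε * ∑ x ∈ F, netFlow w (fun z => v z ^ 2) x := by
    intro x y ⟨hx1, hx2⟩ ⟨hy1, hy2⟩ hxy
    have hdxy : d x y ≤ D := by
      rcases hxy with ⟨h1, h2⟩ | ⟨h1, h2⟩
      · rw [abs_of_nonneg h1] at hx1 hx2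
        rw [abs_of_nonneg h2] at hy1 hy2
        exact hdiam x y (Or.inr ⟨by linarith, by linarith⟩)
          (abs_le.2 ⟨by linarith, by linarith⟩)
      · rw [abs_of_neg h1] at hx1 hx2
        rw [abs_of_neg h2] at hy1 hy2
        exact hdiam x y (Or.inl ⟨by linarith, by linarith⟩)
          (abs_le.2 ⟨by linarith, by linarith⟩)
    refine (H.graph.sq_sub_le_energy hε hw hv (F := F) fun z hz => ?_).trans ?_
    · have h1 := (abs_abs_sub_abs_le_abs_sub (g y) (g z)).trans
        (H.graph.abs_sub_le H.ext.lip z y)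
      obtain ⟨h2, h3⟩ := abs_le.1 h1
      rw [hF, Finset.mem_sdiff, H.mem_level, H.mem_level, not_le]
      constructor <;> linarith
    · have h1 : d x y ^ 2 ≤ D ^ 2 := pow_le_pow_left₀ (H.graph.dist_nonneg x y) hdxy 2
      exact mul_le_mul_of_nonneg_right (div_le_div_of_nonneg_right h1 hε.le)
        (Finset.sum_nonneg fun x _ => hΓ x)
  obtain ⟨c, hc⟩ := exists_center (v := v) (p := fun x => (T - 1 ≤ |g x| ∧ |g x| ≤ T + 2) ∧ 0 ≤ g x)
    fun x y hx hy => hosc x y hx.1 hy.1 (Or.inl ⟨hx.2, hy.2⟩)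
  obtain ⟨c', hc'⟩ := exists_center (v := v)
    (p := fun x => (T - 1 ≤ |g x| ∧ |g x| ≤ T + 2) ∧ g x < 0)
    fun x y hx hy => hosc x y hx.1 hy.1 (Or.inr ⟨hx.2, hy.2⟩)
  have h1 := hcac v hv hfl T _ c c' (by linarith)
    (mul_nonneg (by positivity) (Finset.sum_nonneg fun x _ => hΓ x))
    (fun x h1 h2 h3 => hc x ⟨⟨h1, h2⟩, h3⟩) (fun x h1 h2 h3 => hc' x ⟨⟨h1, h2⟩, h3⟩)
  rw [hFsum, ← mul_assoc, ← hC'] at h1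
  have h2 := hmono s T (by linarith)
  have h3 := hmono s (s + (2 * D + 4)) (by linarith)
  have h4 : E s ≤ (C' + 1) * (E (s + (2 * D + 4)) - E s) := by
    have h5 : E s ≤ C' * (E (s + (2 * D + 4)) - E s) := h2.trans h1
    linarith
  have h5 : 1 / (C' + 1) * E s ≤ E (s + (2 * D + 4)) - E s := by
    rw [one_div_mul_eq_div, div_le_iff₀ (by linarith)]
    linarith
  change (1 + 1 / (C' + 1)) * E s ≤ E (s + (2 * D + 4))
  linarith

/-- A harmonic function of subexponential growth without flow between the ends is constant. -/
theorem eq_of_growth (H : HarmonicProfile w m d X Y K g) {v : V → ℝ}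
    (hv : ∀ x, netFlow w v x = 0) (hfl : bdFlow w (H.level 1) {v | 0 ≤ g v} v = 0) (x₀ : V)
    (hgr : ∀ δ, 0 < δ → ∃ C, 0 ≤ C ∧ ∀ z, |v z| ≤ C * Real.exp (δ * d x₀ z)) (x : V) :
    v x = v x₀ := by
  obtain ⟨k, q, s₀, hk, hq, hs₀, hE⟩ := H.exists_energy_growth
  obtain ⟨C, hC, hup⟩ := H.exists_energy_le
  obtain ⟨M, hM, has⟩ := H.exists_abs_asymptotics x₀
  have hΓ : ∀ x, 0 ≤ netFlow w (fun z => v z ^ 2) x := fun x => H.graph.netFlow_sq_nonneg (hv x)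
  set δ := Real.log q / (4 * k) with hδdef
  have hδ : 0 < δ := div_pos (Real.log_pos hq) (by linarith)
  obtain ⟨B, hB, hvB⟩ := hgr δ hδ
  set E : ℝ → ℝ := fun t => ∑ x ∈ H.level t, netFlow w (fun z => v z ^ 2) x with hEdef
  have hE0 : ∀ s, s₀ ≤ s → E s ≤ 0 := by
    intro s hs
    have hlow : ∀ n : ℕ, q ^ n * E s ≤ E (s + n * k) := by
      intro n
      induction n with
      | zero => simp
      | succ n ih =>
        have h1 : s₀ ≤ s + n * k := by
          have : 0 ≤ (n : ℝ) * k := by positivity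
          linarith
        have h2 : q * E (s + n * k) ≤ E (s + n * k + k) := hE v hv hfl _ h1
        have h3 := mul_le_mul_of_nonneg_left ih (by linarith : (0 : ℝ) ≤ q)
        have h4 : s + ((n + 1 : ℕ) : ℝ) * k = s + n * k + k := by push_cast; ring
        rw [h4, pow_succ']
        linarith
    set Q := Real.exp (2 * δ * k) with hQ
    have hQ1 : 1 < Q := Real.one_lt_exp_iff.2 (by positivity)
    have hQq : Q ^ 2 = q := by
      rw [hQ, ← Real.exp_nat_mul, hδdef]
      have : ((2 : ℕ) : ℝ) * (2 * (Real.log q / (4 * k)) * k) = Real.log q := by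
        field_simp
        ring
      rw [this, Real.exp_log (by linarith)]
    have hhigh : ∀ n : ℕ, E (s + n * k) ≤ C * (B * Real.exp (δ * (s + 2 + M))) ^ 2 * Q ^ n := by
      intro n
      have h := hup v hv (s + n * k) (B * Real.exp (δ * (s + n * k + 2 + M)))
        (by have : 0 ≤ (n : ℝ) * k := by positivity
            linarith)
        (fun z hz => (hvB z).trans <| by
          refine mul_le_mul_of_nonneg_left (Real.exp_le_exp.2 ?_) hB
          refine mul_le_mul_of_nonneg_left ?_ hδ.le
          linarith [(abs_le.1 (has z)).1])
      refine h.trans_eq ?_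
      have h1 : Real.exp (δ * (s + n * k + 2 + M)) ^ 2 =
          Real.exp (δ * (s + 2 + M)) ^ 2 * Q ^ n := by
        rw [hQ, ← Real.exp_nat_mul, ← Real.exp_nat_mul, ← Real.exp_nat_mul, ← Real.exp_add]
        congr 1
        push_cast
        ring
      rw [mul_pow, mul_pow, h1]
      ring
    set B' := C * (B * Real.exp (δ * (s + 2 + M))) ^ 2 with hB'
    by_contra! hpos
    have hlim : Tendsto (fun n : ℕ => Q ^ n * E s) atTop atTop :=
      (tendsto_pow_atTop_atTop_of_one_lt hQ1).atTop_mul_const hpos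
    obtain ⟨n, hn⟩ := (hlim.eventually (eventually_gt_atTop B')).exists
    have h1 := (hlow n).trans (hhigh n)
    have hQn : 0 < Q ^ n := by positivity
    rw [← hQq, ← pow_mul, mul_comm 2 n, pow_mul, sq, mul_assoc, mul_comm B'] at h1
    linarith [le_of_mul_le_mul_left h1 hQn]
  refine H.graph.of_adj (p := fun z => v z = v x₀) (fun a z haz hz => ?_) rfl x
  have h1 : netFlow w (fun z => v z ^ 2) a ≤ 0 := by
    refine le_trans ?_ (hE0 (max s₀ |g a|) (le_max_left _ _))
    exact Finset.single_le_sum (f := fun u => netFlow w (fun z => v z ^ 2) u)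
      (fun u _ => hΓ u) (H.mem_level.2 (le_max_right _ _))
  have h2 := (H.graph.weight_mul_sq_le (hv a) z).trans h1
  have h3 : (v z - v a) ^ 2 ≤ 0 := by
    by_contra! h
    exact absurd h2 (not_le.2 (mul_pos haz h))
  have h4 : v z - v a = 0 := pow_eq_zero_iff (two_ne_zero) |>.1 (le_antisymm h3 (sq_nonneg _))
  linarith

theorem exists_lt (H : HarmonicProfile w m d X Y K g) (t : ℝ) : ∃ x, g x < t := by
  by_contra! hcon
  have hfin := H.graph.finite_superlevel H.part.separates H.ext t
  have hXfin : X.Finite := hfin.subset fun x hx => ⟨hx, hcon x⟩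
  obtain ⟨-, -, -, -, -, -, hX, -⟩ := H.part
  obtain ⟨F, hF, hlt⟩ := hX (∑ x ∈ hXfin.toFinset, m x)
  refine absurd hlt (not_lt.2 (Finset.sum_le_sum_of_subset_of_nonneg (fun x hx => ?_)
    fun x _ _ => (H.graph.m_pos x).le))
  exact hXfin.mem_toFinset.2 (hF hx)

theorem bdFlow_neg_self (H : HarmonicProfile w m d X Y K g) :
    bdFlow w (H.level 1) {v | 0 ≤ g v} g < 0 := by
  obtain ⟨x, hx⟩ := H.exists_lt 0
  obtain ⟨y, hy⟩ := H.neg.exists_lt 0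
  obtain ⟨a, ha, b, hb, hab⟩ := H.graph.exists_boundary_edge (A := {v | 0 ≤ g v}) (x := y) (y := x)
    (by simpa using (neg_lt_zero.1 hy).le) (not_le.2 hx)
  obtain ⟨ha1, hb1⟩ := H.abs_lt_one_of_crossing ha hb hab
  have hle : ∀ x y, (if x ∈ {v | 0 ≤ g v} ∧ y ∉ {v | 0 ≤ g v} then w x y * (g y - g x) else 0)
      ≤ 0 := by
    intro x y
    split_ifs with h
    · have h1 : 0 ≤ g x := h.1
      have h2 : g y < 0 := not_le.1 h.2
      exact mul_nonpos_of_nonneg_of_nonpos (H.graph.nonneg x y) (by linarith)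
    · exact le_rfl
  refine Finset.sum_neg' (fun x _ => Finset.sum_nonpos fun y _ => hle x y)
    ⟨a, H.mem_level.2 ha1.le, Finset.sum_neg' (fun y _ => hle a y) ⟨b, H.mem_level.2 hb1, ?_⟩⟩
  rw [if_pos ⟨ha, hb⟩]
  have h1 : 0 ≤ g a := ha
  have h2 : g b < 0 := not_le.1 hb
  exact mul_neg_of_pos_of_neg hab (by linarith)

theorem subexpGrowth (H : HarmonicProfile w m d X Y K g) (x₀ : V) : SubexpGrowth d x₀ g := by
  obtain ⟨M, -, hM⟩ := H.exists_abs_asymptotics x₀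
  obtain ⟨z, hz⟩ := H.exists_lt 0
  exact subexpGrowth_of_le_dist H.graph (C := M) (fun z => by linarith [(abs_le.1 (hM z)).2]) hz.ne

/-- Harmonic functions of subexponential growth are affine functions of `g`. -/
theorem exists_affine (H : HarmonicProfile w m d X Y K g) {u : V → ℝ}
    (hu : ∀ x, netFlow w u x = 0) (x₀ : V) (hgr : SubexpGrowth d x₀ u) :
    ∃ a b : ℝ, ∀ z, u z = a + b * g z := by
  set β := bdFlow w (H.level 1) {v | 0 ≤ g v} g with hβ
  have hβ0 : β ≠ 0 := H.bdFlow_neg_self.ne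
  set b := bdFlow w (H.level 1) {v | 0 ≤ g v} u / β with hb
  have hv : ∀ x, netFlow w (fun z => u z - b * g z) x = 0 := fun x => by
    have h : netFlow w (fun z => b * g z) x = b * netFlow w g x := by
      simp only [H.graph.netFlow_nbrs, Finset.mul_sum]
      exact Finset.sum_congr rfl fun y _ => by ring
    rw [H.graph.netFlow_sub u fun z => b * g z, h, hu, H.harm, mul_zero, sub_zero]
  have hfl : bdFlow w (H.level 1) {v | 0 ≤ g v} (fun z => u z - b * g z) = 0 := by
    rw [bdFlow_sub w _ _ u fun z => b * g z, bdFlow_const_mul, ← hβ, hb, div_mul_cancel₀ _ hβ0,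
      sub_self]
  have hconst := H.eq_of_growth hv hfl x₀ fun δ hδ => by
    obtain ⟨C, hC, hCu⟩ := hgr.exists_bound H.graph hδ
    obtain ⟨C', hC', hCg⟩ := (H.subexpGrowth x₀).exists_bound H.graph hδ
    refine ⟨C + |b| * C', by positivity, fun z => (abs_sub _ _).trans ?_⟩
    rw [abs_mul, add_mul, mul_assoc]
    exact add_le_add (hCu z) (mul_le_mul_of_nonneg_left (hCg z) (abs_nonneg b))
  exact ⟨u x₀ - b * g x₀, b, fun z => by linarith [hconst z]⟩

end HarmonicProfile

theorem exists_harmonicProfile {w : V → V → ℝ} {m : V → ℝ} (hS : IsSalami w m (combDist w))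
    {ε : ℝ} (hε : 0 < ε) (hw : ∀ x y, 0 < w x y → ε ≤ w x y) (x₀ : V) :
    ∃ X Y K g, HarmonicProfile w m (combDist w) X Y K g := by
  obtain ⟨hB, hK, X, Y, K, P⟩ := hS
  have G := curvedGraph_of_salami hB hK
  have S := P.separates
  obtain ⟨R, hR, hKR⟩ := exists_ball_superset (combDist w) S.fin x₀
  have P' := G.salamiPartition_of_cover (G.finite_ball x₀ R)
    (fun v => (S.cover v).imp_right fun h => h.imp_right fun h => hKR h) S.disjXY S.nonadj
    P.2.2.2.2.2.2.1 P.2.2.2.2.2.2.2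
  obtain ⟨g, hE, hg⟩ := G.exists_harmonic_extremal hR P'
  exact ⟨_, _, _, g, G, P', hE, fun v => (G.netFlow_eq_zero_iff g v).1 (hg v), ε, hε, hw⟩

/-- **Corollary (Subexponentially growing harmonic functions).** For a salami
with combinatorial distance and edge weights bounded below by `ε`, the space of
harmonic functions of subexponential growth has dimension exactly two. -/
theorem salami_subexp_harmonic_dim_two {V : Type*} (w : V → V → ℝ) (m : V → ℝ)
    (hS : IsSalami w m (combDist w))
    (ε : ℝ) (hε : 0 < ε) (hw : ∀ x y, 0 < w x y → ε ≤ w x y)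
    (x : V) :
    ∃ u₁ u₂ : V → ℝ,
      ((∀ z, lap w m u₁ z = 0) ∧ SubexpGrowth (combDist w) x u₁) ∧
      ((∀ z, lap w m u₂ z = 0) ∧ SubexpGrowth (combDist w) x u₂) ∧
      (∀ a b : ℝ, (∀ z, a * u₁ z + b * u₂ z = 0) → a = 0 ∧ b = 0) ∧
      (∀ u : V → ℝ, (∀ z, lap w m u z = 0) → SubexpGrowth (combDist w) x u →
        ∃ a b : ℝ, ∀ z, u z = a * u₁ z + b * u₂ z) := by
  obtain ⟨X, Y, K, g, H⟩ := exists_harmonicProfile hS hε hw x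
  refine ⟨fun _ => 1, g, ⟨fun z => ?_, ?_⟩, ⟨fun z => ?_, H.subexpGrowth x⟩,
    fun a b hab => ?_, fun u hu hgr => ?_⟩
  · exact (H.graph.netFlow_eq_zero_iff _ z).2 (netFlow_const w 1 z)
  · exact subexpGrowth_of_le_dist H.graph (C := 1) (z₀ := x)
      (fun z => by simpa using H.graph.dist_nonneg x z) one_ne_zero
  · exact (H.graph.netFlow_eq_zero_iff g z).2 (H.harm z)
  · obtain ⟨y, hy⟩ := H.exists_lt (g x)
    have h1 := hab x
    have h2 := hab y
    have hb : b = 0 := by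
      have : b * (g x - g y) = 0 := by linarith
      exact (mul_eq_zero.1 this).resolve_right (sub_pos.2 hy).ne'
    rw [hb] at h1
    exact ⟨by linarith, hb⟩
  · obtain ⟨a, b, h⟩ := H.exists_affine
      (fun z => (H.graph.netFlow_eq_zero_iff u z).1 (hu z)) x hgr
    exact ⟨a, b, fun z => by rw [h z, mul_one]⟩

end SalamiPaper
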